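/- Let q be a square prime power of characteristic p, and suppose 2 ≤ p ≤ √q − 1. Then R_q(p) ≥ 1/p − 1/(√q − 1) + (1 − (log_q p)/(√q + 1))/(p·(√q − 1)). (This is the instance for square q, where Ihara's constant satisfies A(q) = √q − 1 and the p-torsion limit satisfies J_p(q, √q−1) ≤ (log_q p)/(√q+1).) -/

import Mathlib

open Filter

/-- The set of descendants of a set `A ⊆ S^n` of words: all words agreeing in each
coordinate with some word of `A`. -/
def descSet {S : Type*} {n : ℕ} (A : Set (Fin n → S)) : Set (Fin n → S) :=
  {x | ∀ i, ∃ a ∈ A, x i = a i}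

/-- A `q`-ary `s`-frameproof code of length `n`: for every `A ⊆ C` with `|A| ≤ s`,
`desc(A) ∩ C = A`. -/
def IsFrameproof {S : Type*} {n : ℕ} (s : ℕ) (C : Set (Fin n → S)) : Prop :=
  ∀ A ⊆ C, A.ncard ≤ s → descSet A ∩ C = A

/-- `M_q(n,s)`: the maximal size of a `q`-ary `s`-frameproof code of length `n`. -/
noncomputable def Mfp (q n s : ℕ) : ℕ :=
  sSup {M | ∃ C : Set (Fin n → Fin q), IsFrameproof s C ∧ C.ncard = M}

/-- `R_q(s) = limsup_{n→∞} log_q M_q(n,s) / n`. -/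
noncomputable def Rfp (q s : ℕ) : ℝ :=
  limsup (fun n => Real.logb q (Mfp q n s) / (n : ℝ)) atTop

/-- The field `k` has `l ^ 2` elements, where `l` is a positive power of the prime `p`. -/
class IsSquareField (k : Type) [Field k] (p l : ℕ) : Prop where
  prime : p.Prime
  charP : CharP k p
  exists_pow : ∃ m, 1 ≤ m ∧ l = p ^ m
  finite : Finite k
  card : Nat.card k = l ^ 2

namespace IsSquareField

variable (k : Type) [Field k] (p l : ℕ) [hk : IsSquareField k p l]

include hk

theorem two_le : 2 ≤ l := by
  obtain ⟨m, hm, rfl⟩ := exists_pow k (p := p) (l := l)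
  exact (prime k (p := p) (l := p ^ m)).two_le.trans (Nat.le_self_pow (by omega) p)

theorem dvd : p ∣ l := by
  obtain ⟨m, hm, rfl⟩ := exists_pow k (p := p) (l := l)
  exact dvd_pow_self p (by omega)

theorem add_pow {R : Type} [CommRing R] [Algebra k R] (x y : R) :
    (x + y) ^ l = x ^ l + y ^ l := by
  rcases subsingleton_or_nontrivial R with h | h
  · exact Subsingleton.elim _ _
  obtain ⟨m, hm, rfl⟩ := exists_pow k (p := p) (l := l)
  have : Fact p.Prime := ⟨prime k (l := p ^ m)⟩
  have : CharP k p := charP (l := p ^ m)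
  have : CharP R p := charP_of_injective_algebraMap (algebraMap k R).injective p
  exact add_pow_char_pow x y p m

theorem neg_pow {R : Type} [CommRing R] [Algebra k R] (x : R) : (-x) ^ l = -x ^ l := by
  have h := add_pow k p l x (-x)
  have h0 := two_le k p l
  rw [add_neg_cancel, zero_pow (by omega)] at h
  exact eq_neg_of_add_eq_zero_right h.symm

theorem sub_pow {R : Type} [CommRing R] [Algebra k R] (x y : R) :
    (x - y) ^ l = x ^ l - y ^ l := by
  rw [sub_eq_add_neg, add_pow k p l, neg_pow k p l, ← sub_eq_add_neg]

theorem pow_pow (a : k) : (a ^ l) ^ l = a := by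
  have := finite p l (k := k)
  have := Fintype.ofFinite k
  have h := FiniteField.pow_card a
  rwa [← Nat.card_eq_fintype_card, card (p := p) (l := l), sq, pow_mul] at h

/-- The additive map `a ↦ a ^ l + a`. -/
def artin : k →+ k where
  toFun a := a ^ l + a
  map_zero' := by have := two_le k p l; simp; omega
  map_add' x y := by rw [add_pow k p l]; ring

theorem artin_apply (a : k) : artin k p l a = a ^ l + a := rfl

theorem artin_pow (a : k) : artin k p l a ^ l = artin k p l a := by
  rw [artin_apply, add_pow k p l, pow_pow k p l, add_comm]

open Polynomial in
theorem ncard_le_of_roots (P : k[X]) (hP : P ≠ 0) (hd : P.natDegree ≤ l) (S : Set k)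
    (hS : ∀ x ∈ S, P.eval x = 0) : S.ncard ≤ l := by
  classical
  have := finite p l (k := k)
  have h1 : S ⊆ (P.roots.toFinset : Set k) := by
    intro x hx
    simp [hP, hS x hx]
  calc S.ncard ≤ (P.roots.toFinset : Set k).ncard := Set.ncard_le_ncard h1 (Set.toFinite _)
    _ = P.roots.toFinset.card := Set.ncard_coe_finset _
    _ ≤ P.roots.card := P.roots.toFinset_card_le
    _ ≤ P.natDegree := P.card_roots'
    _ ≤ l := hd

theorem card_ker_and_range :
    Nat.card (artin k p l).ker = l ∧ Nat.card (artin k p l).range = l := by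
  have := finite p l (k := k)
  have h0 := two_le k p l
  have hprod : Nat.card (artin k p l).ker * Nat.card (artin k p l).range = l ^ 2 := by
    rw [← card (k := k) (p := p) (l := l), mul_comm, ← Nat.card_congr
      (QuotientAddGroup.quotientKerEquivRange (artin k p l)).toEquiv]
    exact ((artin k p l).ker.card_eq_card_quotient_mul_card_addSubgroup).symm
  have h1 : Nat.card (artin k p l).ker ≤ l := by
    refine ncard_le_of_roots k p l (Polynomial.X ^ l + Polynomial.X) ?_ ?_
      ((artin k p l).ker : Set k) ?_
    · intro h
      have := congrArg (fun f => Polynomial.coeff f 1) h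
      have hne : ¬ 1 = l := by omega
      simp [Polynomial.coeff_X_pow, hne] at this
    · compute_degree
      omega
    · intro x hx
      simpa [artin_apply] using hx
  have h2 : Nat.card (artin k p l).range ≤ l := by
    refine ncard_le_of_roots k p l (Polynomial.X ^ l - Polynomial.X) ?_ ?_
      ((artin k p l).range : Set k) ?_
    · intro h
      have := congrArg (fun f => Polynomial.coeff f 1) h
      have hne : ¬ 1 = l := by omega
      simp [Polynomial.coeff_X_pow, hne] at this
    · compute_degree
      omega
    · rintro _ ⟨x, rfl⟩
      simp [artin_pow k p l]
  constructor <;> nlinarith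

theorem exists_artin_eq (b : k) (hb : b ^ l = b) : ∃ a, a ^ l + a = b := by
  have := finite p l (k := k)
  have h0 := two_le k p l
  have hsub : ((artin k p l).range : Set k) ⊆ {b : k | b ^ l = b} := by
    rintro _ ⟨x, rfl⟩
    exact artin_pow k p l x
  have hle : ({b : k | b ^ l = b} : Set k).ncard ≤ l := by
    refine ncard_le_of_roots k p l (Polynomial.X ^ l - Polynomial.X) ?_ ?_ _ ?_
    · intro h
      have := congrArg (fun f => Polynomial.coeff f 1) h
      have hne : ¬ 1 = l := by omega
      simp [Polynomial.coeff_X_pow, hne] at this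
    · compute_degree
      omega
    · intro x hx
      simpa [sub_eq_zero] using hx
  have heq := Set.eq_of_subset_of_ncard_le hsub
    (hle.trans (card_ker_and_range k p l).2.ge) (Set.toFinite _)
  have : b ∈ ((artin k p l).range : Set k) := by rw [heq]; exact hb
  obtain ⟨a, ha⟩ := this
  exact ⟨a, ha⟩

theorem card_fixed : Nat.card {b : k // b ^ (l - 1) = 1} = l - 1 := by
  have := finite p l (k := k)
  have h0 := two_le k p l
  have heq : ((artin k p l).range : Set k) = {b : k | b ^ l = b} := by
    ext b
    constructor
    · rintro ⟨x, rfl⟩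
      exact artin_pow k p l x
    · intro hb
      obtain ⟨a, ha⟩ := exists_artin_eq k p l b hb
      exact ⟨a, ha⟩
  have h1 : ({b : k | b ^ l = b} : Set k).ncard = l := by
    rw [← heq]
    exact (card_ker_and_range k p l).2
  have h2 : {b : k | b ^ l = b} = insert 0 {b : k | b ^ (l - 1) = 1} := by
    ext b
    simp only [Set.mem_ofPred_eq, Set.mem_insert_iff]
    obtain ⟨i, rfl⟩ : ∃ i, l = i + 2 := ⟨l - 2, by omega⟩
    rw [show i + 2 - 1 = i + 1 by omega]
    by_cases hb : b = 0
    · simp [hb]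
    · rw [pow_succ]
      constructor
      · intro h; right; exact mul_right_cancel₀ hb (by rw [h, one_mul])
      · rintro (h | h)
        · exact absurd h hb
        · rw [h, one_mul]
  have h3 : (insert 0 {b : k | b ^ (l - 1) = 1} : Set k).ncard
      = ({b : k | b ^ (l - 1) = 1} : Set k).ncard + 1 := by
    refine Set.ncard_insert_of_notMem ?_ (Set.toFinite _)
    have h4 : l - 1 ≠ 0 := by omega
    simp [h4]
  rw [h2, h3] at h1
  change ({b : k | b ^ (l - 1) = 1} : Set k).ncard = l - 1
  omega

end IsSquareField

/-- An exhaustive descending multiplicative filtration of a `k`-algebra by subspaces. -/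
structure Filt (k E : Type) [Field k] [CommRing E] [Algebra k E] where
  /-- The subspace of elements of order at least `b`. -/
  L : ℤ → Submodule k E
  anti : ∀ {a b : ℤ}, a ≤ b → ∀ {x : E}, x ∈ L b → x ∈ L a
  mul : ∀ {a b : ℤ} {x y : E}, x ∈ L a → y ∈ L b → x * y ∈ L (a + b)
  one : (1 : E) ∈ L 0
  exh : ∀ x : E, ∃ b, x ∈ L b

namespace Filt

variable {k E : Type} [Field k] [CommRing E] [Algebra k E] (F : Filt k E)

theorem mul' {a b c : ℤ} {x y : E} (hx : x ∈ F.L a) (hy : y ∈ F.L b) (h : c ≤ a + b) :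
    x * y ∈ F.L c :=
  F.anti h (F.mul hx hy)

theorem pow {a : ℤ} {x : E} (hx : x ∈ F.L a) (n : ℕ) : x ^ n ∈ F.L (n * a) := by
  induction n with
  | zero => simpa using F.one
  | succ n ih =>
    rw [pow_succ]
    exact F.mul' ih hx (by push_cast; linarith)

theorem pow' {a c : ℤ} {x : E} (hx : x ∈ F.L a) (n : ℕ) (h : c ≤ n * a) : x ^ n ∈ F.L c :=
  F.anti h (F.pow hx n)

theorem algebraMap_mem (c : k) : algebraMap k E c ∈ F.L 0 := by
  rw [Algebra.algebraMap_eq_smul_one]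
  exact (F.L 0).smul_mem c F.one

theorem prod {ι : Type} (s : Finset ι) (f : ι → E) (a : ℤ) (h : ∀ i ∈ s, f i ∈ F.L a) :
    ∏ i ∈ s, f i ∈ F.L (s.card * a) := by
  classical
  induction s using Finset.induction_on with
  | empty => simpa using F.one
  | insert i s hi ih =>
    rw [Finset.prod_insert hi, Finset.card_insert_of_notMem hi]
    exact F.mul' (h i (by simp)) (ih fun j hj => h j (by simp [hj])) (by push_cast; linarith)

/-- Multiplication by `1 - t` with `t` of positive order does not raise orders. -/
theorem mem_of_sub_mul_mem {t u : E} {b : ℤ} (ht : t ∈ F.L 1) (h : u - t * u ∈ F.L b) :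
    u ∈ F.L b := by
  obtain ⟨c, hc⟩ := F.exh u
  have key : ∀ n : ℕ, u ∈ F.L (c + n) ∨ u ∈ F.L b := by
    intro n
    induction n with
    | zero => left; simpa using hc
    | succ n ih =>
      rcases ih with ih | ih
      · have h1 : t * u ∈ F.L (c + (n + 1 : ℕ)) := F.mul' ht ih (by push_cast; linarith)
        rcases le_total b (c + (n + 1 : ℕ)) with hle | hle
        · right
          have := (F.L b).add_mem h (F.anti hle h1)
          rwa [sub_add_cancel] at this
        · left
          have := (F.L _).add_mem (F.anti hle h) h1
          rwa [sub_add_cancel] at this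
      · exact Or.inr ih
  rcases key (b - c).toNat with h1 | h1
  · exact F.anti (by have := Int.self_le_toNat (b - c); linarith) h1
  · exact h1

theorem mem_of_add_mul_mem {t u : E} {b : ℤ} (ht : t ∈ F.L 1) (h : u + t * u ∈ F.L b) :
    u ∈ F.L b :=
  F.mem_of_sub_mul_mem (t := -t) ((F.L 1).neg_mem ht) (by simpa using h)

end Filt

/-- The quotient of the subspace `S` by `S'` has dimension at most `n`. -/
def Codim {k E : Type} [Field k] [CommRing E] [Algebra k E] (n : ℕ) (S S' : Submodule k E) :
    Prop :=
  ∃ Φ : E →ₗ[k] (Fin n → k), ∀ x ∈ S, Φ x = 0 → x ∈ S'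

namespace Codim

variable {k E : Type} [Field k] [CommRing E] [Algebra k E]

theorem of_fintype {ι : Type} [Fintype ι] {S S' : Submodule k E} (Φ : E →ₗ[k] (ι → k))
    (h : ∀ x ∈ S, Φ x = 0 → x ∈ S') : Codim (Fintype.card ι) S S' := by
  refine ⟨(LinearMap.funLeft k k (Fintype.equivFin ι).symm) ∘ₗ Φ, fun x hx h0 => h x hx ?_⟩
  ext i
  have := congrFun h0 (Fintype.equivFin ι i)
  simpa [LinearMap.funLeft] using this

theorem refl (S : Submodule k E) : Codim 0 S S := ⟨0, fun _ hx _ => hx⟩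

theorem trans {m n : ℕ} {S S' S'' : Submodule k E} (h : Codim m S S') (h' : Codim n S' S'') :
    Codim (m + n) S S'' := by
  obtain ⟨Φ, hΦ⟩ := h
  obtain ⟨Ψ, hΨ⟩ := h'
  have := of_fintype (ι := Fin m ⊕ Fin n) (S := S) (S' := S'')
    (LinearMap.pi (Sum.elim (fun i => LinearMap.proj i ∘ₗ Φ) fun i => LinearMap.proj i ∘ₗ Ψ)) ?_
  · simpa using this
  · intro x hx h0
    refine hΨ x (hΦ x hx ?_) ?_
    · ext i
      simpa using congrFun h0 (Sum.inl i)
    · ext i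
      simpa using congrFun h0 (Sum.inr i)

theorem shift (F : Filt k E) {n : ℕ} (h : Codim n (F.L 0) (F.L 1)) {t t' : E} (ht : t ∈ F.L 1)
    (ht' : t' ∈ F.L (-1)) (htt : t * t' = 1) (a : ℕ) :
    Codim n (F.L (-a)) (F.L (-a + 1)) := by
  obtain ⟨Φ, hΦ⟩ := h
  refine ⟨Φ ∘ₗ LinearMap.mulLeft k (t ^ a), fun x hx h0 => ?_⟩
  have h1 := hΦ (t ^ a * x) (F.mul' (F.pow ht a) hx (by simp)) (by simpa using h0)
  have h2 := F.mul (F.pow ht' a) h1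
  rw [← mul_assoc, ← mul_pow, mul_comm t' t, htt, one_pow, one_mul] at h2
  exact F.anti (by simp) h2

theorem range (F : Filt k E) {n : ℕ} (h : Codim n (F.L 0) (F.L 1)) {t t' : E} (ht : t ∈ F.L 1)
    (ht' : t' ∈ F.L (-1)) (htt : t * t' = 1) (a d : ℕ) :
    Codim (n * d) (F.L (-(a + d : ℕ))) (F.L (-a)) := by
  induction d with
  | zero => simpa using refl _
  | succ d ih =>
    rw [mul_add, mul_one, add_comm]
    refine trans ?_ ih
    have := shift F h ht ht' htt (a + (d + 1))
    convert this using 2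
    push_cast; ring

end Codim

/-- The Artin–Schreier type polynomial `X ^ l + X - w`. -/
noncomputable def asPoly {E : Type} [CommRing E] (l : ℕ) (w : E) : Polynomial E :=
  Polynomial.X ^ l + Polynomial.X - Polynomial.C w

/-- The extension ring `E[X] / (X ^ l + X - w)`. -/
abbrev AS {E : Type} [CommRing E] (l : ℕ) (w : E) : Type := AdjoinRoot (asPoly l w)

namespace AS

open Polynomial

variable {k E : Type} [Field k] [CommRing E] [Algebra k E] {l : ℕ} [hl : Fact (2 ≤ l)] {w : E}

theorem degree_sub_lt (w : E) (l : ℕ) (hl : 2 ≤ l) : (X - C w : E[X]).degree < l := by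
  refine lt_of_le_of_lt (b := ((1 : ℕ) : WithBot ℕ)) ?_ (by exact_mod_cast hl)
  compute_degree
  simp

include hl in
theorem monic : (asPoly l w).Monic := by
  rw [asPoly, add_sub_assoc]
  exact monic_X_pow_add (degree_sub_lt w l hl.out)

include hl in
theorem degree_eq [Nontrivial E] : (asPoly l w).degree = l := by
  rw [asPoly, add_sub_assoc, degree_add_eq_left_of_degree_lt]
  · simp
  · rw [degree_X_pow]
    exact degree_sub_lt w l hl.out

/-- The reduced polynomial representing an element. -/
noncomputable def rep : AS l w →ₗ[E] E[X] := AdjoinRoot.modByMonicHom monic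

theorem mk_rep (x : AS l w) : AdjoinRoot.mk _ (rep x) = x := AdjoinRoot.mk_leftInverse monic x

theorem rep_mk {P : E[X]} (hP : P.degree < l) : rep (AdjoinRoot.mk (asPoly l w) P) = P := by
  nontriviality E
  rw [rep, AdjoinRoot.modByMonicHom_mk, modByMonic_eq_self_iff monic, degree_eq]
  exact hP

theorem degree_rep_lt (x : AS l w) : (rep x).degree < l := by
  rcases subsingleton_or_nontrivial E with h | h
  · rw [Subsingleton.elim (rep x) 0, degree_zero]
    exact WithBot.bot_lt_coe l
  obtain ⟨P, rfl⟩ := AdjoinRoot.mk_surjective x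
  rw [rep, AdjoinRoot.modByMonicHom_mk, ← degree_eq (w := w)]
  exact degree_modByMonic_lt _ monic

theorem rep_coeff_eq_zero (x : AS l w) {s : ℕ} (hs : l ≤ s) : (rep x).coeff s = 0 :=
  coeff_eq_zero_of_degree_lt ((degree_rep_lt x).trans_le (by exact_mod_cast hs))

theorem rep_injective : Function.Injective (rep : AS l w → E[X]) :=
  (AdjoinRoot.mk_leftInverse monic).injective

/-- The adjoined root. -/
noncomputable abbrev root (l : ℕ) (w : E) : AS l w := AdjoinRoot.root _

/-- The inclusion of the base ring. -/
noncomputable abbrev of (k : Type) [Field k] [Algebra k E] (l : ℕ) (w : E) : E →ₐ[k] AS l w :=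
  AdjoinRoot.ofAlgHom k _

omit hl in
theorem root_pow : root l w ^ l = of k l w w - root l w := by
  have h : ∀ f, f = asPoly l w → f.eval₂ (AdjoinRoot.of (asPoly l w)) (root l w) = 0 := by
    rintro f rfl
    exact AdjoinRoot.eval₂_root _
  have := h (X ^ l + X - C w) rfl
  rw [eval₂_sub, eval₂_add, eval₂_pow, eval₂_X, eval₂_C] at this
  simp only [AdjoinRoot.coe_ofAlgHom]
  linear_combination this

theorem rep_of_mul_pow (c : E) {s : ℕ} (hs : s < l) :
    rep (of k l w c * root l w ^ s) = C c * X ^ s := by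
  have : of k l w c * root l w ^ s = AdjoinRoot.mk _ (C c * X ^ s) := by
    simp [AdjoinRoot.mk_X]
  rw [this, rep_mk]
  exact (degree_C_mul_X_pow_le s c).trans_lt (by exact_mod_cast hs)

theorem rep_of (c : E) : rep (of k l w c) = C c := by
  have := rep_of_mul_pow (k := k) (w := w) (l := l) c (s := 0) (by have := hl.out; omega)
  simpa using this

theorem eq_sum (k : Type) [Field k] [Algebra k E] (x : AS l w) :
    x = ∑ s ∈ Finset.range l, of k l w ((rep x).coeff s) * root l w ^ s := by
  have h1 : (rep x).natDegree < l := by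
    have := hl.out
    rcases eq_or_ne (rep x) 0 with h | h
    · rw [h]; simp; omega
    · exact (natDegree_lt_iff_degree_lt h).2 (degree_rep_lt x)
  conv_lhs => rw [← mk_rep x, (rep x).as_sum_range' l h1]
  simp [map_sum, ← C_mul_X_pow_eq_monomial, AdjoinRoot.mk_X]

/-- Homomorphisms out of the extension. -/
noncomputable def lift {T : Type} [CommRing T] [Algebra k T] (φ : E →ₐ[k] T) (x : T)
    (h : x ^ l + x = φ w) : AS l w →ₐ[k] T :=
  AdjoinRoot.liftAlgHom _ φ x (by simp [asPoly, h])

omit hl in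
theorem lift_of {T : Type} [CommRing T] [Algebra k T] (φ : E →ₐ[k] T) (x : T)
    (h : x ^ l + x = φ w) (c : E) : lift φ x h (of k l w c) = φ c :=
  AdjoinRoot.liftAlgHom_of _ _ _ _ _

omit hl in
theorem lift_root {T : Type} [CommRing T] [Algebra k T] (φ : E →ₐ[k] T) (x : T)
    (h : x ^ l + x = φ w) : lift φ x h (root l w) = x :=
  AdjoinRoot.liftAlgHom_root _ _ _ _

theorem lift_eq {T : Type} [CommRing T] [Algebra k T] (φ : E →ₐ[k] T) (x : T)
    (h : x ^ l + x = φ w) (u : AS l w) :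
    lift φ x h u = ((rep u).map (φ : E →+* T)).eval x := by
  conv_lhs => rw [← mk_rep u]
  rw [eval_map]
  exact AdjoinRoot.liftAlgHom_mk _ _ _ _ _

theorem rep_smul (c : k) (x : AS l w) : rep (c • x) = c • rep x := by
  have h := (rep (l := l) (w := w)).map_smul (algebraMap k E c) x
  rw [algebraMap_smul] at h
  rw [h, algebraMap_smul]

end AS

/-- The filtration on `E[X] / (X ^ l + X - w)` for which `X` has order `-ν` and the elements of
order `a` of `E` get order `μ * a`. -/
noncomputable def Filt.ext {k E : Type} [Field k] [CommRing E] [Algebra k E] (F : Filt k E)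
    {l : ℕ} [hl : Fact (2 ≤ l)] {w : E} (μ ν ω : ℤ) (hμ : 0 < μ) (hν : 0 ≤ ν)
    (h : μ * ω = ν * l) (hw : w ∈ F.L (-ω)) : Filt k (AS l w) := by
  let L : ℤ → Submodule k (AS l w) := fun b =>
    { carrier := {x | ∀ s : ℕ, s < l → ∃ a, b + ν * s ≤ μ * a ∧ (AS.rep x).coeff s ∈ F.L a}
      zero_mem' := fun s _ => ⟨|b + ν * s|, by
        nlinarith [le_abs_self (b + ν * s), abs_nonneg (b + ν * s)], by simp⟩
      add_mem' := by
        intro x y hx hy s hs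
        obtain ⟨a, ha, hx⟩ := hx s hs
        obtain ⟨c, hc, hy⟩ := hy s hs
        rcases le_total a c with hac | hac
        · exact ⟨a, ha, by rw [map_add, Polynomial.coeff_add]; exact add_mem hx (F.anti hac hy)⟩
        · exact ⟨c, hc, by rw [map_add, Polynomial.coeff_add]; exact add_mem (F.anti hac hx) hy⟩
      smul_mem' := by
        intro c x hx s hs
        obtain ⟨a, ha, hx⟩ := hx s hs
        refine ⟨a, ha, ?_⟩
        rw [AS.rep_smul, Polynomial.coeff_smul]
        exact (F.L a).smul_mem c hx }
  have anti : ∀ {a b : ℤ}, a ≤ b → ∀ {x : AS l w}, x ∈ L b → x ∈ L a := by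
    intro a b hab x hx s hs
    obtain ⟨c, hc, hx⟩ := hx s hs
    exact ⟨c, by linarith, hx⟩
  have mono : ∀ (s : ℕ) (a b : ℤ) (c : E), c ∈ F.L a → b + ν * s ≤ μ * a →
      AS.of k l w c * AS.root l w ^ s ∈ L b := by
    intro s
    induction s using Nat.strong_induction_on with
    | _ s ih =>
      intro a b c hc hb
      rcases lt_or_ge s l with hs | hs
      · intro t ht
        rw [AS.rep_of_mul_pow c hs, Polynomial.coeff_C_mul_X_pow]
        split_ifs with hts
        · subst hts
          exact ⟨a, hb, hc⟩
        · exact ⟨|b + ν * t|, by nlinarith [le_abs_self (b + ν * t), abs_nonneg (b + ν * t)],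
            by simp⟩
      · obtain ⟨i, rfl⟩ := Nat.exists_eq_add_of_le hs
        have h2 := hl.out
        have e : AS.of k l w c * AS.root l w ^ (l + i) =
            AS.of k l w (c * w) * AS.root l w ^ i - AS.of k l w c * AS.root l w ^ (i + 1) := by
          rw [pow_add, AS.root_pow (k := k), map_mul]
          ring
        rw [e]
        push_cast at hb
        refine sub_mem (ih i (by omega) (a - ω) b _ (F.mul hc hw) ?_)
          (ih (i + 1) (by omega) a b c hc ?_)
        · nlinarith
        · have : (1 : ℤ) ≤ l := by omega
          push_cast
          nlinarith
  exact
    { L := L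
      anti := anti
      mul := by
        intro a b x y hx hy
        rw [AS.eq_sum k x, AS.eq_sum k y, Finset.sum_mul_sum]
        refine sum_mem fun s hs => sum_mem fun t ht => ?_
        obtain ⟨c, hc, hx⟩ := hx s (Finset.mem_range.1 hs)
        obtain ⟨d, hd, hy⟩ := hy t (Finset.mem_range.1 ht)
        have := mono (s + t) (c + d) (a + b) _ (F.mul hx hy) (by push_cast; nlinarith)
        rw [map_mul, pow_add] at this
        convert this using 1
        ring
      one := by simpa using mono 0 0 0 1 F.one (by simp)
      exh := by
        intro x
        have : ∀ S : Finset ℕ, ∃ b, ∑ s ∈ S, AS.of k l w ((AS.rep x).coeff s) *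
            AS.root l w ^ s ∈ L b := by
          intro S
          induction S using Finset.induction_on with
          | empty => exact ⟨0, by simp⟩
          | insert s S hs ih =>
            obtain ⟨b, hb⟩ := ih
            obtain ⟨a, ha⟩ := F.exh ((AS.rep x).coeff s)
            rw [Finset.sum_insert hs]
            rcases le_total b (μ * a - ν * s) with hle | hle
            · exact ⟨b, add_mem (mono s a b _ ha (by linarith)) hb⟩
            · exact ⟨_, add_mem (mono s a _ _ ha (by linarith)) (anti hle hb)⟩
        obtain ⟨b, hb⟩ := this (Finset.range l)
        exact ⟨b, by rwa [AS.eq_sum k x]⟩ }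

/-- The next function in the tower: `X ^ (l + 1) / w`, where `v = 1 / w`. -/
def nextW {T : Type} [CommRing T] (l : ℕ) (X v : T) : T := X ^ (l + 1) * v

/-- The inverse of `X` when `X ^ l + X = w` and `v = 1 / w`. -/
def rootInv {T : Type} [CommRing T] (l : ℕ) (X v : T) : T := (X ^ (l - 1) + 1) * v

/-- The inverse of `nextW l X v`. -/
def nextV {T : Type} [CommRing T] (l : ℕ) (X v : T) : T := rootInv l X v ^ l + rootInv l X v

section identities

variable {T T' : Type} [CommRing T] [CommRing T'] {l : ℕ} {X w v : T}

theorem map_nextW {k : Type} [Field k] [Algebra k T] [Algebra k T'] (φ : T →ₐ[k] T') :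
    φ (nextW l X v) = nextW l (φ X) (φ v) := by
  simp [nextW]

theorem map_nextV {k : Type} [Field k] [Algebra k T] [Algebra k T'] (φ : T →ₐ[k] T') :
    φ (nextV l X v) = nextV l (φ X) (φ v) := by
  simp [nextV, rootInv]

theorem mul_rootInv (hl : 2 ≤ l) (hX : X ^ l + X = w) (hv : w * v = 1) :
    X * rootInv l X v = 1 := by
  obtain ⟨i, rfl⟩ : ∃ i, l = i + 1 := ⟨l - 1, by omega⟩
  rw [rootInv, Nat.add_sub_cancel]
  linear_combination v * hX + hv

theorem nextW_mul_nextV (hl : 2 ≤ l) (hX : X ^ l + X = w) (hv : w * v = 1) :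
    nextW l X v * nextV l X v = 1 := by
  have h := mul_rootInv hl hX hv
  calc nextW l X v * nextV l X v
      = ((X * rootInv l X v) ^ l * X + X ^ l * (X * rootInv l X v)) * v := by
        rw [nextW, nextV]; ring
    _ = 1 := by rw [h, one_pow, one_mul, mul_one, add_comm, hX, hv]

theorem nextW_eq (hX : X ^ l + X = w) (hv : w * v = 1) :
    nextW l X v = X - X ^ 2 * v := by
  have : X ^ l = w - X := by rw [← hX]; ring
  rw [nextW, pow_succ, this]
  linear_combination X * hv

end identities

section filtered

variable {k T : Type} [Field k] [CommRing T] [Algebra k T] (F : Filt k T) {l : ℕ} {X v : T}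

theorem rootInv_mem {a : ℤ} (ha : 0 ≤ a) (hl : 1 ≤ l) (hX : X ∈ F.L (-a)) (hv : v ∈ F.L (l * a)) :
    rootInv l X v ∈ F.L a := by
  refine F.mul' (a := -((l - 1 : ℕ) * a)) (add_mem (F.pow' hX _ (by linarith)) ?_) hv ?_
  · exact F.anti (by have := mul_nonneg (Int.natCast_nonneg (l - 1)) ha; linarith) F.one
  · push_cast [hl]
    linarith

theorem nextV_mem {a : ℤ} (ha : 0 ≤ a) (hl : 1 ≤ l) (hX : X ∈ F.L (-a)) (hv : v ∈ F.L (l * a)) :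
    nextV l X v ∈ F.L a := by
  have h := rootInv_mem F ha hl hX hv
  exact add_mem (F.pow' h l (by nlinarith [(by exact_mod_cast hl : (1 : ℤ) ≤ l)])) h

theorem nextW_mem (hX : X ∈ F.L (-1)) (hv : v ∈ F.L l) : nextW l X v ∈ F.L (-1) :=
  F.mul' (F.pow hX _) hv (by push_cast; linarith)

end filtered

namespace Filt

variable {k E : Type} [Field k] [CommRing E] [Algebra k E] (F : Filt k E)
    {l : ℕ} [hl : Fact (2 ≤ l)] {w : E}

/-- The totally ramified extension of a filtration. -/
noncomputable def ram (hw : w ∈ F.L (-1)) : Filt k (AS l w) :=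
  F.ext l 1 1 (by have := hl.out; omega) (by simp) (by simp) hw

/-- The unramified extension of a filtration. -/
noncomputable def etale (hw : w ∈ F.L 0) : Filt k (AS l w) :=
  F.ext 1 0 0 (by simp) (by simp) (by simp) (by simpa using hw)

theorem mem_ram (hw : w ∈ F.L (-1)) {x : AS l w} {b : ℤ} : x ∈ (F.ram hw).L b ↔
    ∀ s : ℕ, s < l → ∃ a, b + 1 * s ≤ l * a ∧ (AS.rep x).coeff s ∈ F.L a := Iff.rfl

theorem mem_ram_iff (hw : w ∈ F.L (-1)) {x : AS l w} (a : ℤ) : x ∈ (F.ram hw).L (l * a - l + 1) ↔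
    ∀ s : ℕ, s < l → (AS.rep x).coeff s ∈ F.L a := by
  rw [mem_ram]
  refine forall_congr' fun s => forall_congr' fun hs => ⟨?_, fun h => ⟨a, by omega, h⟩⟩
  rintro ⟨c, hc, h⟩
  refine F.anti ?_ h
  by_contra hac
  nlinarith [(by exact_mod_cast hl.out : (2 : ℤ) ≤ l)]

theorem of_mem_ram (hw : w ∈ F.L (-1)) {x : E} {a : ℤ} (hx : x ∈ F.L a) :
    AS.of k l w x ∈ (F.ram hw).L (l * a) := by
  rw [mem_ram]
  intro s hs
  rw [AS.rep_of, Polynomial.coeff_C]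
  have h2 := hl.out
  split_ifs with h
  · exact ⟨a, by simp [h], hx⟩
  · exact ⟨|l * a + 1 * s|, by
      nlinarith [le_abs_self ((l : ℤ) * a + 1 * s), abs_nonneg ((l : ℤ) * a + 1 * s),
        (by exact_mod_cast hl.out : (2 : ℤ) ≤ l)], by simp⟩

theorem rep_root : AS.rep (AS.root l w) = Polynomial.X := by
  rw [AS.root, ← AdjoinRoot.mk_X, AS.rep_mk]
  exact Polynomial.degree_X_le.trans_lt (by exact_mod_cast hl.out)

theorem root_mem_ram (hw : w ∈ F.L (-1)) : AS.root l w ∈ (F.ram hw).L (-1) := by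
  rw [mem_ram]
  intro s hs
  rw [rep_root, Polynomial.coeff_X]
  split_ifs with h
  · exact ⟨0, by simp [← h], F.one⟩
  · exact ⟨s, by
      nlinarith [(by exact_mod_cast hl.out : (2 : ℤ) ≤ l)], by simp⟩

theorem mem_etale (hw : w ∈ F.L 0) {x : AS l w} {a : ℤ} : x ∈ (F.etale hw).L a ↔
    ∀ s : ℕ, s < l → (AS.rep x).coeff s ∈ F.L a := by
  refine forall_congr' fun s => forall_congr' fun hs => ⟨?_, fun h => ⟨a, by simp, h⟩⟩
  rintro ⟨c, hc, h⟩
  exact F.anti (by linarith) h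

theorem of_mem_etale (hw : w ∈ F.L 0) {x : E} {a : ℤ} (hx : x ∈ F.L a) :
    AS.of k l w x ∈ (F.etale hw).L a := by
  rw [mem_etale]
  intro s hs
  rw [AS.rep_of, Polynomial.coeff_C]
  split_ifs with h
  · exact hx
  · simp

theorem root_mem_etale (hw : w ∈ F.L 0) : AS.root l w ∈ (F.etale hw).L 0 := by
  rw [mem_etale]
  intro s hs
  rw [rep_root, Polynomial.coeff_X]
  split_ifs with h
  · exact F.one
  · simp

/-- The `s`-th coefficient as a `k`-linear map. -/
noncomputable def _root_.AS.cf (k : Type) {E : Type} [Field k] [CommRing E] [Algebra k E]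
    {l : ℕ} [Fact (2 ≤ l)] (w : E) (s : ℕ) : AS l w →ₗ[k] E where
  toFun x := (AS.rep x).coeff s
  map_add' x y := by simp
  map_smul' c x := by simp

theorem codim_ram (hw : w ∈ F.L (-1)) {n : ℕ} (h : Codim n (F.L 0) (F.L 1)) :
    Codim n ((F.ram (l := l) hw).L 0) ((F.ram (l := l) hw).L 1) := by
  obtain ⟨Φ, hΦ⟩ := h
  refine ⟨Φ ∘ₗ AS.cf k w 0, fun x hx h0 => ?_⟩
  have h1 := (F.mem_ram_iff hw (x := x) 1).2 ?_
  · simpa using h1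
  intro s hs
  obtain ⟨a, ha, hxa⟩ := hx s hs
  rcases Nat.eq_zero_or_pos s with rfl | h3
  · refine hΦ _ (F.anti ?_ hxa) h0
    by_contra hneg
    nlinarith [(by exact_mod_cast hl.out : (2 : ℤ) ≤ l)]
  · refine F.anti ?_ hxa
    by_contra hneg
    nlinarith [(by exact_mod_cast hl.out : (2 : ℤ) ≤ l)]

theorem codim_etale (hw : w ∈ F.L 0) {n : ℕ} (h : Codim n (F.L 0) (F.L 1)) :
    Codim (l * n) ((F.etale (l := l) hw).L 0) ((F.etale (l := l) hw).L 1) := by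
  obtain ⟨Φ, hΦ⟩ := h
  have := Codim.of_fintype (ι := Fin l × Fin n) (S := (F.etale (l := l) hw).L 0)
    (S' := (F.etale (l := l) hw).L 1)
    (LinearMap.pi fun i => LinearMap.proj i.2 ∘ₗ Φ ∘ₗ AS.cf k w i.1) ?_
  · simpa using this
  intro x hx h0
  rw [mem_etale] at hx ⊢
  intro s hs
  refine hΦ _ (hx s hs) ?_
  ext i
  exact congrFun h0 (⟨s, hs⟩, i)

end Filt

/-- The filtration is the order at a totally ramified pole of `w = 1 / v`. -/
structure IsPole {k A : Type} [Field k] [CommRing A] [Algebra k A] (F : Filt k A) (w v : A) :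
    Prop where
  mul_eq : w * v = 1
  w_mem : w ∈ F.L (-1)
  v_mem : v ∈ F.L 1
  const : ∀ x ∈ F.L 0, ∃ c : k, x - algebraMap k A c ∈ F.L 1
  one_notMem : (1 : A) ∉ F.L 1
  sep : ∀ x, (∀ b, x ∈ F.L b) → x = 0

namespace IsPole

variable {k A : Type} [Field k] [CommRing A] [Algebra k A] {F : Filt k A} {w v : A}

theorem ram {l : ℕ} [hl : Fact (2 ≤ l)] (h : IsPole F w v) :
    IsPole (F.ram (l := l) h.w_mem) (nextW l (AS.root l w) (AS.of k l w v))
      (nextV l (AS.root l w) (AS.of k l w v)) := by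
  have hl2 := hl.out
  have hl3 : (2 : ℤ) ≤ l := by exact_mod_cast hl2
  have hv : AS.of k l w v ∈ (F.ram (l := l) h.w_mem).L l := by
    simpa using F.of_mem_ram (l := l) h.w_mem h.v_mem
  have hX := F.root_mem_ram (l := l) h.w_mem
  have e1 : AS.root l w ^ l + AS.root l w = AS.of k l w w := by rw [AS.root_pow (k := k)]; ring
  have e2 : AS.of k l w w * AS.of k l w v = 1 := by rw [← map_mul, h.mul_eq, map_one]
  refine ⟨nextW_mul_nextV hl2 e1 e2, nextW_mem _ hX hv,
    nextV_mem _ (by simp) (by omega) hX (by simpa using hv), ?_, ?_, ?_⟩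
  · intro x hx
    obtain ⟨a, ha, h0⟩ := hx 0 (by omega)
    obtain ⟨c, hc⟩ := h.const _ (F.anti (by nlinarith) h0)
    refine ⟨c, ?_⟩
    have h1 := (F.mem_ram_iff h.w_mem (x := x - algebraMap k (AS l w) c) 1).2 ?_
    · simpa using h1
    intro s hs
    have e : algebraMap k (AS l w) c = AS.of k l w (algebraMap k A c) := by simp
    rw [map_sub, Polynomial.coeff_sub, e, AS.rep_of, Polynomial.coeff_C]
    split_ifs with hs0
    · subst hs0; exact hc
    · rw [sub_zero]
      obtain ⟨a, ha, h0⟩ := hx s hs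
      have : 1 ≤ s := by omega
      exact F.anti (by nlinarith) h0
  · intro h1
    have h1' : (1 : AS l w) ∈ (F.ram h.w_mem).L (l * 1 - l + 1) := by simpa using h1
    have h2 := (F.mem_ram_iff h.w_mem _).1 h1' 0 (by omega)
    rw [← map_one (AS.of k l w), AS.rep_of, Polynomial.coeff_C_zero] at h2
    exact h.one_notMem h2
  · intro x hx
    apply AS.rep_injective
    rw [map_zero]
    ext s
    rcases lt_or_ge s l with hs | hs
    · rw [Polynomial.coeff_zero]
      exact h.sep _ fun b => (F.mem_ram_iff h.w_mem _).1 (hx _) s hs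
    · rw [AS.rep_coeff_eq_zero _ hs, Polynomial.coeff_zero]

theorem noZeroDivisors (h : IsPole F w v) {x y : A} (hxy : x * y = 0) : x = 0 ∨ y = 0 := by
  by_contra hne
  push Not at hne
  have key : ∀ x : A, x ≠ 0 → ∃ (t : A) (c : k), c ≠ 0 ∧ x * t - algebraMap k A c ∈ F.L 1 := by
    intro x hx
    obtain ⟨b₀, hb₀⟩ := F.exh x
    have hex : ∃ b, x ∉ F.L b := by
      by_contra hcon
      push Not at hcon
      exact hx (h.sep x hcon)
    obtain ⟨b₁, hb₁⟩ := hex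
    obtain ⟨b, hb, hmax⟩ := Int.exists_greatest_of_bdd (P := fun b => x ∈ F.L b)
      ⟨b₁, fun z hz => by by_contra hlt; exact hb₁ (F.anti (by omega) hz)⟩ ⟨b₀, hb₀⟩
    obtain ⟨t, t', ht, ht', htt⟩ : ∃ t t' : A, t ∈ F.L (-b) ∧ t' ∈ F.L b ∧ t * t' = 1 := by
      have hpow : (∀ n : ℕ, w ^ n ∈ F.L (-n) ∧ v ^ n ∈ F.L n ∧ w ^ n * v ^ n = 1) := fun n =>
        ⟨F.pow' h.w_mem n (by simp), F.pow' h.v_mem n (by simp), by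
          rw [← mul_pow, h.mul_eq, one_pow]⟩
      rcases le_total 0 b with hb0 | hb0
      · lift b to ℕ using hb0
        exact ⟨_, _, (hpow b).1, (hpow b).2.1, (hpow b).2.2⟩
      · obtain ⟨n, rfl⟩ : ∃ n : ℕ, b = -n := ⟨b.natAbs, by omega⟩
        exact ⟨v ^ n, w ^ n, by simpa using (hpow n).2.1, (hpow n).1, by
          rw [mul_comm]; exact (hpow n).2.2⟩
    obtain ⟨c, hc⟩ := h.const (x * t) (F.mul' hb ht (by simp))
    refine ⟨t, c, ?_, hc⟩
    rintro rfl
    rw [map_zero, sub_zero] at hc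
    have h1 := F.mul hc ht'
    rw [mul_assoc, htt, mul_one] at h1
    have := hmax _ h1
    omega
  obtain ⟨t, c, hc, hxt⟩ := key x hne.1
  obtain ⟨t', c', hc', hyt⟩ := key y hne.2
  have h1 : algebraMap k A (c * c') ∈ F.L 1 := by
    have e : algebraMap k A (c * c') = -((x * t - algebraMap k A c) * (y * t' - algebraMap k A c')
        + algebraMap k A c * (y * t' - algebraMap k A c')
        + (x * t - algebraMap k A c) * algebraMap k A c') := by
      rw [map_mul]
      linear_combination (t * t') * hxy
    rw [e]
    refine neg_mem (add_mem (add_mem (F.mul' hxt hyt (by simp)) ?_) ?_)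
    · exact F.mul' (F.algebraMap_mem c) hyt (by simp)
    · exact F.mul' hxt (F.algebraMap_mem c') (by simp)
  refine h.one_notMem ?_
  have := (F.L 1).smul_mem (c * c')⁻¹ h1
  rwa [Algebra.algebraMap_eq_smul_one, smul_smul, inv_mul_cancel₀ (mul_ne_zero hc hc'),
    one_smul] at this

theorem aeval_notMem (h : IsPole F w v) {P : Polynomial k} (hP : P ≠ 0) :
    Polynomial.aeval w P ∉ F.L 1 := by
  intro hmem
  have h1 : v ^ P.natDegree * Polynomial.aeval w P ∈ F.L 1 :=
    F.mul' (F.pow h.v_mem P.natDegree) hmem (by simp)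
  rw [Polynomial.aeval_eq_sum_range, Finset.sum_range_succ, mul_add, Finset.mul_sum] at h1
  have h2 : ∑ i ∈ Finset.range P.natDegree, v ^ P.natDegree * P.coeff i • w ^ i ∈ F.L 1 := by
    refine sum_mem fun i hi => ?_
    have hi := Finset.mem_range.1 hi
    rw [mul_smul_comm]
    exact Submodule.smul_mem _ _ (F.mul' (F.pow h.v_mem _) (F.pow h.w_mem _) (by omega))
  have h3 := ((F.L 1).add_mem_iff_right h2).1 h1
  rw [mul_smul_comm, ← mul_pow, mul_comm, h.mul_eq, one_pow] at h3
  have h4 := (F.L 1).smul_mem (P.leadingCoeff)⁻¹ h3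
  rw [smul_smul, Polynomial.coeff_natDegree, inv_mul_cancel₀ (by simpa using hP), one_smul] at h4
  exact h.one_notMem h4

end IsPole

/-- The field of Laurent series, with the algebra structure given by constant series. -/
def LS (k : Type) [Field k] : Type := LaurentSeries k

section LaurentSeries

variable (k : Type) [Field k]

noncomputable instance : Field (LS k) := inferInstanceAs (Field (LaurentSeries k))

noncomputable instance : Algebra k (LS k) :=
  RingHom.toAlgebra (HahnSeries.C : k →+* HahnSeries ℤ k)

variable {k}

/-- The coefficients of a Laurent series. -/
def LS.coeff (x : LS k) (i : ℤ) : k := HahnSeries.coeff (Γ := ℤ) x i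

/-- The Laurent series `c * T ^ a`. -/
noncomputable def LS.single (a : ℤ) (c : k) : LS k := (HahnSeries.single a c : HahnSeries ℤ k)

theorem LS.coeff_add (x y : LS k) (i : ℤ) : (x + y).coeff i = x.coeff i + y.coeff i := rfl

theorem LS.coeff_sub (x y : LS k) (i : ℤ) : (x - y).coeff i = x.coeff i - y.coeff i :=
  HahnSeries.coeff_sub (Γ := ℤ) (R := k)

theorem LS.coeff_zero (i : ℤ) : (0 : LS k).coeff i = 0 := rfl

theorem LS.coeff_smul (c : k) (x : LS k) (i : ℤ) : (c • x).coeff i = c * x.coeff i := by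
  have h1 : ∀ y : HahnSeries ℤ k,
      HahnSeries.coeff (HahnSeries.C c * y) i = c * HahnSeries.coeff y i := by
    intro y
    rw [HahnSeries.C_mul_eq_smul, HahnSeries.coeff_smul, smul_eq_mul]
  rw [Algebra.smul_def]
  exact h1 x

theorem LS.coeff_single (a : ℤ) (c : k) (i : ℤ) :
    (LS.single a c).coeff i = if i = a then c else 0 :=
  HahnSeries.coeff_single.trans (by congr)

theorem LS.coeff_mul_eq_zero {x y : LS k} {a b i : ℤ} (hx : ∀ i < a, x.coeff i = 0)
    (hy : ∀ i < b, y.coeff i = 0) (hi : i < a + b) : (x * y).coeff i = 0 := by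
  refine (HahnSeries.coeff_mul (Γ := ℤ) (R := k)).trans (Finset.sum_eq_zero fun ij hij => ?_)
  have h := (Finset.mem_antidiagonal.1 hij).2.2
  rcases lt_or_ge ij.1 a with h1 | h1
  · exact mul_eq_zero_of_left (hx _ h1) _
  · exact mul_eq_zero_of_right _ (hy ij.2 (by omega))

theorem LS.coeff_one (i : ℤ) : (1 : LS k).coeff i = if i = 0 then 1 else 0 :=
  (HahnSeries.coeff_one (Γ := ℤ) (R := k)).trans (by congr)

variable (k) in
/-- The `T`-adic filtration on Laurent series. -/
noncomputable def ordFilt : Filt k (LS k) where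
  L b :=
    { carrier := {x | ∀ i < b, x.coeff i = 0}
      zero_mem' := fun i _ => LS.coeff_zero i
      add_mem' := fun hx hy i hi => by rw [LS.coeff_add, hx i hi, hy i hi, add_zero]
      smul_mem' := fun c x hx i hi => by rw [LS.coeff_smul, hx i hi, mul_zero] }
  anti h x hx i hi := hx i (hi.trans_le h)
  mul hx hy i hi := LS.coeff_mul_eq_zero hx hy hi
  one i hi := by rw [LS.coeff_one, if_neg (by omega)]
  exh x := ⟨HahnSeries.order (Γ := ℤ) (R := k) x, fun i hi =>
    HahnSeries.coeff_eq_zero_of_lt_order (Γ := ℤ) (R := k) hi⟩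

theorem mem_ordFilt {x : LS k} {b : ℤ} :
    x ∈ (ordFilt k).L b ↔ ∀ i < b, x.coeff i = 0 := Iff.rfl

theorem single_mem_ordFilt (a : ℤ) (c : k) : LS.single a c ∈ (ordFilt k).L a := by
  rw [mem_ordFilt]
  intro i hi
  rw [LS.coeff_single, if_neg (by omega)]

theorem codim_ordFilt : Codim 1 ((ordFilt k).L 0) ((ordFilt k).L 1) := by
  refine ⟨LinearMap.pi fun _ => ⟨⟨fun x => x.coeff 0, fun x y => LS.coeff_add x y 0⟩,
    fun c x => LS.coeff_smul c x 0⟩, fun x hx h0 => ?_⟩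
  rw [mem_ordFilt] at hx ⊢
  intro i hi
  rcases lt_or_ge i 0 with h | h
  · exact hx i h
  · obtain rfl : i = 0 := by omega
    exact congrFun h0 0

theorem powerSeries_exists_root {p l : ℕ} [hk : IsSquareField k p l] (f : PowerSeries k)
    (hf : PowerSeries.X ∣ f) : ∃ g : PowerSeries k, PowerSeries.X ∣ g ∧ g ^ l + g = f := by
  have hl := IsSquareField.two_le k p l
  let S : ℕ → PowerSeries k := fun n => ∑ i ∈ Finset.range n, (-1) ^ i * f ^ l ^ i
  have hdvd : ∀ n, (PowerSeries.X : PowerSeries k) ^ n ∣ f ^ l ^ n := fun n =>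
    (pow_dvd_pow_of_dvd hf n).trans (pow_dvd_pow f (Nat.lt_pow_self (by omega)).le)
  have hS : ∀ n, S n ^ l + S n = f + (-1) ^ (n + 1) * f ^ l ^ n := by
    intro n
    induction n with
    | zero => simp [S]; omega
    | succ n ih =>
      have e : S (n + 1) = S n + (-1) ^ n * f ^ l ^ n := Finset.sum_range_succ _ _
      have e1 : ((-1 : PowerSeries k) ^ n) ^ l = -(-1) ^ (n + 1) := by
        rw [← pow_mul, mul_comm, pow_mul, IsSquareField.neg_pow k p l, one_pow]
        ring
      rw [e, IsSquareField.add_pow k p l, mul_pow, e1, ← pow_mul, ← pow_succ]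
      linear_combination ih
  have hmono : ∀ n m, n ≤ m → (PowerSeries.X : PowerSeries k) ^ n ∣ S m - S n := by
    intro n m hnm
    induction m, hnm using Nat.le_induction with
    | base => simp
    | succ m hm ih =>
      have e : S (m + 1) = S m + (-1) ^ m * f ^ l ^ m := Finset.sum_range_succ _ _
      rw [e, add_sub_right_comm]
      exact dvd_add ih (Dvd.dvd.mul_left ((pow_dvd_pow _ hm).trans (hdvd m)) _)
  let g : PowerSeries k := PowerSeries.mk fun n => PowerSeries.coeff n (S (n + 1))
  have hg : ∀ n, (PowerSeries.X : PowerSeries k) ^ n ∣ g - S n := by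
    intro n
    rw [PowerSeries.X_pow_dvd_iff]
    intro m hm
    have := PowerSeries.X_pow_dvd_iff.1 (hmono (m + 1) n hm) m (by omega)
    rw [map_sub, PowerSeries.coeff_mk]
    rw [map_sub] at this
    linear_combination -this
  have hgX : (PowerSeries.X : PowerSeries k) ∣ g := by
    have h1 := hg 1
    rw [pow_one] at h1
    have h2 : S 1 = f := by simp [S]
    have := dvd_add h1 (h2 ▸ hf : PowerSeries.X ∣ S 1)
    simpa using this
  refine ⟨g, hgX, ?_⟩
  rw [← sub_eq_zero]
  ext n
  have e : g ^ l + g - f = (g - S (n + 1)) * ((g - S (n + 1)) ^ (l - 1) + 1)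
      + (-1) ^ (n + 1 + 1) * f ^ l ^ (n + 1) := by
    have e1 : (g - S (n + 1)) * ((g - S (n + 1)) ^ (l - 1) + 1) =
        (g - S (n + 1)) ^ l + (g - S (n + 1)) := by
      rw [mul_add, mul_one, ← pow_succ', show l - 1 + 1 = l by omega]
    rw [e1, IsSquareField.sub_pow k p l]
    linear_combination hS (n + 1)
  have h : (PowerSeries.X : PowerSeries k) ^ (n + 1) ∣ g ^ l + g - f := by
    rw [e]
    exact dvd_add (Dvd.dvd.mul_right (hg _) _) (Dvd.dvd.mul_left (hdvd _) _)
  rw [map_zero]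
  exact PowerSeries.X_pow_dvd_iff.1 h n (by omega)

theorem laurent_exists_root {p l : ℕ} [hk : IsSquareField k p l] {w : LS k}
    (hw : w ∈ (ordFilt k).L 1) : ∃ x ∈ (ordFilt k).L 1, x ^ l + x = w := by
  rw [mem_ordFilt] at hw
  obtain ⟨g, hg, hgf⟩ := powerSeries_exists_root (p := p) (l := l)
    (PowerSeries.mk fun n => w.coeff n) (by
      rw [PowerSeries.X_dvd_iff, ← PowerSeries.coeff_zero_eq_constantCoeff_apply,
        PowerSeries.coeff_mk]
      exact hw _ (by simp))
  have hc : ∀ (f : PowerSeries k) (i : ℤ), LS.coeff (HahnSeries.ofPowerSeries ℤ k f) i =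
      if i < 0 then 0 else PowerSeries.coeff i.natAbs f := fun f i => PowerSeries.coeff_coe f i
  have hmem : ∀ x : LS k, x = HahnSeries.ofPowerSeries ℤ k g → x ∈ (ordFilt k).L 1 := by
    intro x hx
    rw [mem_ordFilt]
    intro i hi
    refine (congrArg (fun y : LS k => LS.coeff y i) hx).trans ((hc g i).trans ?_)
    split_ifs with h
    · rfl
    · obtain rfl : i = 0 := by omega
      rw [PowerSeries.X_dvd_iff] at hg
      simpa using hg
  refine ⟨(HahnSeries.ofPowerSeries ℤ k g : HahnSeries ℤ k), hmem _ rfl, ?_⟩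
  · have h1 : HahnSeries.ofPowerSeries ℤ k g ^ l + HahnSeries.ofPowerSeries ℤ k g =
        (w : HahnSeries ℤ k) := by
      rw [← map_pow, ← map_add, hgf]
      ext i
      refine (hc _ i).trans ?_
      split_ifs with h
      · exact (hw i (by omega)).symm
      · rw [PowerSeries.coeff_mk]
        exact congrArg w.coeff (by omega)
    exact h1

end LaurentSeries

/-- A nonzero element `x` of a filtered field has order exactly `b`. -/
def HasOrd {k K : Type} [Field k] [Field K] [Algebra k K] (F : Filt k K) (x : K) (b : ℤ) : Prop :=
  x ≠ 0 ∧ x ∈ F.L b ∧ x⁻¹ ∈ F.L (-b)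

namespace HasOrd

variable {k K : Type} [Field k] [Field K] [Algebra k K] {F : Filt k K} {x y : K} {a b : ℤ}

theorem mul (hx : HasOrd F x a) (hy : HasOrd F y b) : HasOrd F (x * y) (a + b) :=
  ⟨mul_ne_zero hx.1 hy.1, F.mul hx.2.1 hy.2.1, by
    rw [mul_inv]; exact F.mul' hx.2.2 hy.2.2 (by linarith)⟩

theorem inv (hx : HasOrd F x a) : HasOrd F x⁻¹ (-a) :=
  ⟨inv_ne_zero hx.1, hx.2.2, by rw [inv_inv, neg_neg]; exact hx.2.1⟩

theorem pow (hx : HasOrd F x a) (n : ℕ) : HasOrd F (x ^ n) (n * a) :=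
  ⟨pow_ne_zero n hx.1, F.pow hx.2.1 n, by
    rw [← inv_pow]; exact F.pow' hx.2.2 n (by linarith)⟩

theorem algebraMap {c : k} (hc : c ≠ 0) : HasOrd F (algebraMap k K c) 0 :=
  ⟨by simpa using hc, F.algebraMap_mem c, by
    rw [← map_inv₀]; exact F.algebraMap_mem _⟩

/-- Adding an element of higher order does not change the order, for units. -/
theorem add_of_zero (hone : (1 : K) ∉ F.L 1) (hx : HasOrd F x 0) (hy : y ∈ F.L 1) :
    HasOrd F (x + y) 0 := by
  have h1 : y * x⁻¹ ∈ F.L 1 := F.mul' hy hx.2.2 (by simp)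
  have hne : x + y ≠ 0 := by
    intro h
    have : y = -x := by linear_combination h
    rw [this, neg_mul, mul_inv_cancel₀ hx.1] at h1
    exact hone (by simpa using neg_mem h1)
  refine ⟨hne, add_mem hx.2.1 (F.anti (by simp) hy), ?_⟩
  refine F.mem_of_add_mul_mem h1 (b := -0) ?_
  have : (x + y)⁻¹ + y * x⁻¹ * (x + y)⁻¹ = x⁻¹ := by
    have := hx.1
    field_simp
  rw [this]
  exact hx.2.2

end HasOrd

theorem hasOrd_artin {k K : Type} [Field k] [Field K] [Algebra k K] {F : Filt k K} {x : K} {b : ℤ}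
    {l : ℕ} (hl : 2 ≤ l) (hone : (1 : K) ∉ F.L 1) (hx : HasOrd F x b) (hb : 1 ≤ b) :
    HasOrd F (x ^ l + x) b := by
  have h1 : HasOrd F (1 + x ^ (l - 1)) 0 := by
    refine HasOrd.add_of_zero hone
      (by simpa using HasOrd.algebraMap (F := F) (one_ne_zero (α := k))) ?_
    refine F.pow' hx.2.1 _ ?_
    have : (1 : ℤ) ≤ (l - 1 : ℕ) := by omega
    nlinarith
  have := hx.mul h1
  rw [add_zero, mul_add, mul_one, ← pow_succ', show l - 1 + 1 = l by omega, add_comm] at this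
  exact this

theorem hasOrd_of_artin {k K : Type} [Field k] [Field K] [Algebra k K] {F : Filt k K} {x : K}
    {b : ℤ} {l : ℕ} (hl : 2 ≤ l) (hone : (1 : K) ∉ F.L 1) (hx : x ∈ F.L 1)
    (h : HasOrd F (x ^ l + x) b) : HasOrd F x b := by
  have h1 : HasOrd F (1 + x ^ (l - 1)) 0 := by
    refine HasOrd.add_of_zero hone
      (by simpa using HasOrd.algebraMap (F := F) (one_ne_zero (α := k))) ?_
    refine F.pow' hx _ ?_
    have : (1 : ℤ) ≤ (l - 1 : ℕ) := by omega
    nlinarith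
  have := h.mul h1.inv
  have e : (x ^ l + x) * (1 + x ^ (l - 1))⁻¹ = x := by
    rw [← div_eq_mul_inv, div_eq_iff h1.1, mul_add, mul_one, ← pow_succ',
      show l - 1 + 1 = l by omega, add_comm]
  rw [e] at this
  simpa using this

theorem one_notMem_ordFilt {k : Type} [Field k] : (1 : LS k) ∉ (ordFilt k).L 1 := by
  intro h
  rw [mem_ordFilt] at h
  have := h 0 (by simp)
  rw [LS.coeff_one, if_pos rfl] at this
  exact one_ne_zero this

theorem hasOrd_single {k : Type} [Field k] (a : ℤ) :
    HasOrd (ordFilt k) (LS.single a (1 : k)) a := by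
  have h : LS.single a (1 : k) * LS.single (-a) 1 = 1 := by
    have := HahnSeries.single_mul_single (R := k) (a := a) (b := -a) (r := 1) (s := 1)
    refine this.trans ?_
    rw [mul_one, add_neg_cancel]
    rfl
  have h1 : (LS.single a (1 : k))⁻¹ = LS.single (-a) 1 := inv_eq_of_mul_eq_one_right h
  exact ⟨left_ne_zero_of_mul_eq_one h, single_mem_ordFilt a 1, h1 ▸ single_mem_ordFilt _ _⟩

/-- The sequence of local parameters along the point `0` of the tower. -/
theorem exists_xi (k : Type) [Field k] (p l : ℕ) [hk : IsSquareField k p l] :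
    ∃ ξ : ℕ → LS k, ξ 0 ^ l + ξ 0 = LS.single 1 1 ∧
      (∀ j, ξ (j + 1) ^ l + ξ (j + 1) = ξ j ^ (l + 1) * (ξ j ^ l + ξ j)⁻¹) ∧
      ∀ j, HasOrd (ordFilt k) (ξ j) ((l : ℤ) ^ j) := by
  have hl := IsSquareField.two_le k p l
  have hl' : (1 : ℤ) ≤ l := by omega
  have hstep : ∀ (j : ℕ) (x : LS k), HasOrd (ordFilt k) x ((l : ℤ) ^ j) →
      HasOrd (ordFilt k) (x ^ (l + 1) * (x ^ l + x)⁻¹) ((l : ℤ) ^ (j + 1)) := by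
    intro j x hx
    have := (hx.pow (l + 1)).mul
      (hasOrd_artin hl one_notMem_ordFilt hx (one_le_pow₀ hl')).inv
    convert this using 1
    push_cast
    ring
  have h0 : HasOrd (ordFilt k) (LS.single 1 (1 : k)) ((l : ℤ) ^ 0) := by
    simpa using hasOrd_single (k := k) 1
  have hmem : ∀ (j : ℕ) (w : LS k), HasOrd (ordFilt k) w ((l : ℤ) ^ j) → w ∈ (ordFilt k).L 1 :=
    fun j w hw => (ordFilt k).anti (one_le_pow₀ hl') hw.2.1
  have hroot : ∀ (j : ℕ) (w : LS k), HasOrd (ordFilt k) w ((l : ℤ) ^ j) →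
      ∃ x, HasOrd (ordFilt k) x ((l : ℤ) ^ j) ∧ x ^ l + x = w := by
    intro j w hw
    obtain ⟨x, hx, hxw⟩ := laurent_exists_root (p := p) (l := l) (hmem j w hw)
    exact ⟨x, hasOrd_of_artin hl one_notMem_ordFilt hx (hxw ▸ hw), hxw⟩
  choose! root hroot1 hroot2 using hroot
  let ξ : ℕ → LS k := fun j => Nat.rec (root 0 (LS.single 1 1))
    (fun j x => root (j + 1) (x ^ (l + 1) * (x ^ l + x)⁻¹)) j
  have hord : ∀ j, HasOrd (ordFilt k) (ξ j) ((l : ℤ) ^ j) := by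
    intro j
    induction j with
    | zero => exact hroot1 0 _ h0
    | succ j ih => exact hroot1 (j + 1) _ (hstep j _ ih)
  exact ⟨ξ, hroot2 0 _ h0, fun j => hroot2 (j + 1) _ (hstep j _ (hord j)), hord⟩

/-- A homomorphism from `A` together with a subspace of its target. -/
structure Place (k A : Type) [Field k] [CommRing A] [Algebra k A] where
  /-- The target ring. -/
  E : Type
  [commRing : CommRing E]
  [algebra : Algebra k E]
  /-- The homomorphism. -/
  φ : A →ₐ[k] E
  /-- The subspace. -/
  N : Submodule k E

attribute [instance] Place.commRing Place.algebra

/-- Every element of each of the targets `E i` is uniquely approximated up to the subspaces `N i`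
by an element of `U`. -/
structure IsComplementary {k A κ : Type} [Field k] [CommRing A] [Algebra k A] (U : Submodule k A)
    (P : κ → Place k A) : Prop where
  surj : ∀ η : ∀ i, (P i).E, ∃ u ∈ U, ∀ i, (P i).φ u - η i ∈ (P i).N
  inj : ∀ u ∈ U, (∀ i, (P i).φ u ∈ (P i).N) → u = 0

namespace IsComplementary

open Polynomial

variable {k A κ : Type} [Field k] [CommRing A] [Algebra k A] {U : Submodule k A}
    {P : κ → Place k A}

theorem poly_surj (h : IsComplementary U P) (y : ∀ i, (P i).E) (d : ℕ) (f : ∀ i, (P i).E[X]) :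
    ∃ u : A[X], u.degree < d ∧ (∀ s, u.coeff s ∈ U) ∧ ∀ i, ∀ s < d,
      (taylor (y i) (u.map ((P i).φ : A →+* (P i).E)) - f i).coeff s ∈ (P i).N := by
  induction d generalizing f with
  | zero => exact ⟨0, by simp, by simp, by simp⟩
  | succ d ih =>
    obtain ⟨a, haU, ha⟩ := h.surj fun i => (f i).coeff d
    obtain ⟨u, hd, hu, huf⟩ := ih fun i => f i - taylor (y i) (monomial d ((P i).φ a))
    have hd' : ∀ i, (taylor (y i) (u.map ((P i).φ : A →+* (P i).E))).coeff d = 0 := fun i => by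
      refine coeff_eq_zero_of_degree_lt ?_
      rw [degree_taylor]
      exact degree_map_le.trans_lt hd
    refine ⟨u + monomial d a, ?_, fun s => ?_, fun i s hs => ?_⟩
    · refine (degree_add_le _ _).trans_lt (max_lt (hd.trans (by exact_mod_cast d.lt_succ_self))
        ((degree_monomial_le d a).trans_lt (by exact_mod_cast d.lt_succ_self)))
    · rw [coeff_add, coeff_monomial]
      split_ifs
      · exact add_mem (hu s) haU
      · simpa using hu s
    · have e : taylor (y i) ((u + monomial d a).map ((P i).φ : A →+* (P i).E)) - f i =
          taylor (y i) (u.map ((P i).φ : A →+* (P i).E)) -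
            (f i - taylor (y i) (monomial d ((P i).φ a))) := by
        rw [Polynomial.map_add, map_monomial, map_add]
        simp only [RingHom.coe_coe]
        ring
      rw [e]
      rcases Nat.lt_succ_iff_lt_or_eq.1 hs with hs | rfl
      · exact huf i s hs
      · have e2 : (taylor (y i) (monomial s ((P i).φ a))).coeff s = (P i).φ a := by
          rw [taylor_monomial, coeff_C_mul, coeff_X_add_C_pow]
          simp
        rw [coeff_sub, hd', coeff_sub, e2, zero_sub, neg_sub]
        exact ha i

theorem _root_.Polynomial.taylor_coeff_top {R : Type} [CommRing R] {f : R[X]} {d : ℕ}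
    (hf : f.natDegree ≤ d) (y : R) : (taylor y f).coeff d = f.coeff d := by
  rcases hf.eq_or_lt with rfl | h
  · rw [coeff_taylor_natDegree, leadingCoeff]
  · rw [coeff_eq_zero_of_natDegree_lt h, coeff_eq_zero_of_natDegree_lt (by rwa [natDegree_taylor])]

theorem poly_inj (h : IsComplementary U P) (y : ∀ i, (P i).E) (d : ℕ) (u : A[X]) (hd : u.degree < d)
    (hu : ∀ s, u.coeff s ∈ U) (huN : ∀ i, ∀ s < d,
      (taylor (y i) (u.map ((P i).φ : A →+* (P i).E))).coeff s ∈ (P i).N) : u = 0 := by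
  induction d with
  | zero => simpa using hd
  | succ d ih =>
    have hle : u.natDegree ≤ d := by
      rw [natDegree_le_iff_coeff_eq_zero]
      exact fun m hm => coeff_eq_zero_of_degree_lt (hd.trans_le (by exact_mod_cast hm))
    have h0 : u.coeff d = 0 := by
      refine h.inj _ (hu d) fun i => ?_
      have e : (taylor (y i) (u.map ((P i).φ : A →+* (P i).E))).coeff d = (P i).φ (u.coeff d) := by
        rw [taylor_coeff_top (natDegree_map_le.trans hle), coeff_map]
        rfl
      rw [← e]
      exact huN i d d.lt_succ_self
    refine ih ?_ fun i s hs => huN i s (by omega)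
    rw [degree_lt_iff_coeff_zero]
    intro m hm
    rcases hm.eq_or_lt with rfl | hm
    · exact h0
    · exact coeff_eq_zero_of_natDegree_lt (hle.trans_lt hm)

end IsComplementary

section towers

open Polynomial

variable {k A : Type} [Field k] [CommRing A] [Algebra k A] {l : ℕ} [hl : Fact (2 ≤ l)] {w : A}

/-- The place `P'` of `A[X] / (X ^ l + X - w)` lies over `P`, and membership in the subspace can be
read off from the coefficients with respect to powers of a translate of `X`. -/
def Place.Over (P : Place k A) (P' : Place k (AS l w)) : Prop :=
  ∃ (y : P.E) (cf : P'.E →+ P.E[X]),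
    (∀ u, cf (P'.φ u) = taylor y ((AS.rep u).map (P.φ : A →+* P.E))) ∧
    ∀ x, x ∈ P'.N ↔ ∀ s < l, (cf x).coeff s ∈ P.N

variable {E : Type} [CommRing E] [Algebra k E]

/-- The extension of `φ : A → E` to `A[X] / (X ^ l + X - w)` where `X` is sent to a translate of
the root of `X ^ l + X - w'`. -/
noncomputable def AS.map (φ : A →ₐ[k] E) (y w' : E)
    (h : (AS.root l w' + AS.of k l w' y) ^ l + (AS.root l w' + AS.of k l w' y) =
      AS.of k l w' (φ w)) : AS l w →ₐ[k] AS l w' :=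
  AS.lift ((AS.of k l w').comp φ) (AS.root l w' + AS.of k l w' y) h

omit hl in
theorem AS.map_root (φ : A →ₐ[k] E) (y w' : E)
    (h : (AS.root l w' + AS.of k l w' y) ^ l + (AS.root l w' + AS.of k l w' y) =
      AS.of k l w' (φ w)) : AS.map φ y w' h (AS.root l w) = AS.root l w' + AS.of k l w' y :=
  AS.lift_root _ _ _

omit hl in
theorem AS.map_of (φ : A →ₐ[k] E) (y w' : E)
    (h : (AS.root l w' + AS.of k l w' y) ^ l + (AS.root l w' + AS.of k l w' y) =
      AS.of k l w' (φ w)) (x : A) : AS.map φ y w' h (AS.of k l w x) = AS.of k l w' (φ x) :=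
  AS.lift_of _ _ _ _

theorem AS.rep_map (φ : A →ₐ[k] E) (y w' : E)
    (h : (AS.root l w' + AS.of k l w' y) ^ l + (AS.root l w' + AS.of k l w' y) =
      AS.of k l w' (φ w)) (u : AS l w) :
    AS.rep (AS.map φ y w' h u) = taylor y ((AS.rep u).map (φ : A →+* E)) := by
  have e : AS.map φ y w' h u =
      AdjoinRoot.mk _ (taylor y ((AS.rep u).map (φ : A →+* E))) := by
    refine (AS.lift_eq _ _ _ _).trans ?_
    rw [taylor_apply]
    have h1 : (AS.rep u).map (((AS.of k l w').comp φ : A →ₐ[k] AS l w') : A →+* AS l w') =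
        ((AS.rep u).map (φ : A →+* E)).map (AdjoinRoot.of (asPoly l w')) := by
      rw [Polynomial.map_map]
      rfl
    rw [h1, eval_map]
    generalize (AS.rep u).map (φ : A →+* E) = f
    rw [← AdjoinRoot.aeval_eq, aeval_comp]
    simp [aeval_def, AdjoinRoot.algebraMap_eq]
  rw [e, AS.rep_mk]
  rw [degree_taylor]
  exact degree_map_le.trans_lt (AS.degree_rep_lt u)

theorem Place.over_map (φ : A →ₐ[k] E) (y w' : E)
    (h : (AS.root l w' + AS.of k l w' y) ^ l + (AS.root l w' + AS.of k l w' y) =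
      AS.of k l w' (φ w)) (N : Submodule k E) (N' : Submodule k (AS l w'))
    (hN : ∀ x, x ∈ N' ↔ ∀ s < l, (AS.rep x).coeff s ∈ N) :
    Place.Over ⟨E, φ, N⟩ ⟨AS l w', AS.map φ y w' h, N'⟩ :=
  ⟨y, (AS.rep : AS l w' →ₗ[E] E[X]).toAddMonoidHom, fun u => AS.rep_map φ y w' h u, hN⟩

end towers

/-- The function `W` has a simple pole, with inverse `V`. -/
def HasSimplePole {k E : Type} [Field k] [CommRing E] [Algebra k E] (F : Filt k E) (W V : E) :
    Prop :=
  W ∈ F.L (-1) ∧ V ∈ F.L 1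

/-- The function `W` agrees with `c / (ξ r ^ l + ξ r)` up to an integral element. -/
def HasDeepPole {k E : Type} [Field k] [CommRing E] [Algebra k E] (l : ℕ) (ξ : ℕ → LS k)
    (F : Filt k E) (r : ℕ) (W V : E) : Prop :=
  V ∈ F.L (l ^ r : ℕ) ∧ ∃ ψ : LS k →ₐ[k] E, (∀ b, ∀ x ∈ (ordFilt k).L b, ψ x ∈ F.L b) ∧
    ∃ c : k, c ^ l = c ∧ W - ψ (c • (ξ r ^ l + ξ r)⁻¹) ∈ F.L 0

/-- A component of the ramification locus of the tower. -/
structure Comp (k : Type) [Field k] (l : ℕ) (ξ : ℕ → LS k) {A : Type} [CommRing A] [Algebra k A]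
    (w v z : A) where
  /-- The completed ring. -/
  E : Type
  [commRing : CommRing E]
  [algebra : Algebra k E]
  /-- The completion homomorphism. -/
  φ : A →ₐ[k] E
  /-- The filtration. -/
  F : Filt k E
  /-- The ramification index. -/
  e : ℕ
  /-- The residue degree. -/
  ρ : ℕ
  /-- A uniformizer. -/
  t : E
  /-- The inverse of the uniformizer. -/
  t' : E
  one_le : 1 ≤ e
  codim : Codim ρ (F.L 0) (F.L 1)
  t_mem : t ∈ F.L 1
  t'_mem : t' ∈ F.L (-1)
  mul_eq : t * t' = 1
  z_mem : φ z ∈ F.L e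
  pole : HasSimplePole F (φ w) (φ v) ∨ (e = 1 ∧ ∃ r, HasDeepPole l ξ F r (φ w) (φ v))

attribute [instance] Comp.commRing Comp.algebra

namespace Comp

variable {k : Type} [Field k] {l : ℕ} {ξ : ℕ → LS k} {A : Type} [CommRing A] [Algebra k A]
    {w v z : A}

/-- The place of a component; the subspace consists of the elements allowed by the different. -/
def place (c : Comp k l ξ w v z) : Place k A := ⟨c.E, c.φ, c.F.L (-(c.e - 1 : ℕ))⟩

variable [hl : Fact (2 ≤ l)]

theorem step_simple (c : Comp k l ξ w v z) (hwv : w * v = 1)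
    (hc : HasSimplePole c.F (c.φ w) (c.φ v)) :
    ∃ c' : Comp k l ξ (nextW l (AS.root l w) (AS.of k l w v))
        (nextV l (AS.root l w) (AS.of k l w v)) (AS.of k l w z),
      c'.ρ * c'.e = l * (c.ρ * c.e) ∧ Place.Over c.place c'.place := by
  have h2 := hl.out
  have hroot : AS.root l (c.φ w) ^ l + AS.root l (c.φ w) = AS.of k l _ (c.φ w) := by
    rw [AS.root_pow (k := k)]; ring
  have h : (AS.root l (c.φ w) + AS.of k l (c.φ w) 0) ^ l +
      (AS.root l (c.φ w) + AS.of k l (c.φ w) 0) = AS.of k l (c.φ w) (c.φ w) := by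
    rw [map_zero, add_zero, hroot]
  have hX : AS.map c.φ 0 (c.φ w) h (AS.root l w) = AS.root l (c.φ w) := by
    rw [AS.map_root, map_zero, add_zero]
  have hof : ∀ x, AS.map c.φ 0 (c.φ w) h (AS.of k l w x) = AS.of k l _ (c.φ x) :=
    AS.map_of _ _ _ _
  have hv : AS.of k l (c.φ w) (c.φ w) * AS.of k l (c.φ w) (c.φ v) = 1 := by
    rw [← map_mul, ← map_mul, hwv, map_one, map_one]
  have hrX := c.F.root_mem_ram (l := l) hc.1
  have hvm : AS.of k l (c.φ w) (c.φ v) ∈ (c.F.ram hc.1).L l := by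
    simpa using c.F.of_mem_ram (l := l) hc.1 hc.2
  have hone := c.one_le
  refine ⟨⟨AS l (c.φ w), AS.map c.φ 0 (c.φ w) h, c.F.ram hc.1, l * c.e, c.ρ,
    rootInv l (AS.root l (c.φ w)) (AS.of k l _ (c.φ v)), AS.root l (c.φ w), by nlinarith,
    c.F.codim_ram hc.1 c.codim, rootInv_mem _ (by simp) (by omega) hrX (by simpa using hvm), hrX,
    by rw [mul_comm, mul_rootInv h2 hroot hv], ?_, Or.inl ⟨?_, ?_⟩⟩, by ring, ?_⟩
  · rw [hof]
    push_cast
    exact c.F.of_mem_ram hc.1 c.z_mem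
  · have := map_nextW (l := l) (X := AS.root l w) (v := AS.of k l w v)
      (AS.map c.φ 0 (c.φ w) h)
    rw [this, hX, hof]
    exact nextW_mem _ hrX hvm
  · have := map_nextV (l := l) (X := AS.root l w) (v := AS.of k l w v)
      (AS.map c.φ 0 (c.φ w) h)
    rw [this, hX, hof]
    exact nextV_mem _ (by simp) (by omega) hrX (by simpa using hvm)
  · refine Place.over_map c.φ 0 (c.φ w) h _ _ fun x => ?_
    rw [← c.F.mem_ram_iff hc.1]
    have : 1 ≤ l * c.e := by nlinarith
    have e : ((-(l * c.e - 1 : ℕ) : ℤ)) = l * (-(c.e - 1 : ℕ)) - l + 1 := by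
      push_cast [this, hone]
      ring
    simp only [e]

variable {p : ℕ}

theorem step_deep [hk : IsSquareField k p l]
    (hξ : ∀ j, ξ (j + 1) ^ l + ξ (j + 1) = ξ j ^ (l + 1) * (ξ j ^ l + ξ j)⁻¹)
    (hord : ∀ j, HasOrd (ordFilt k) (ξ j) ((l : ℤ) ^ j))
    (c : Comp k l ξ w v z) (hwv : w * v = 1) (he : c.e = 1) {r : ℕ}
    (hc : HasDeepPole l ξ c.F (r + 1) (c.φ w) (c.φ v)) :
    ∃ c' : Comp k l ξ (nextW l (AS.root l w) (AS.of k l w v))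
        (nextV l (AS.root l w) (AS.of k l w v)) (AS.of k l w z),
      c'.ρ * c'.e = l * (c.ρ * c.e) ∧ Place.Over c.place c'.place := by
  obtain ⟨hv, ψ, hψ, b, hb, hW⟩ := hc
  have h2 := hl.out
  have hl2 : (2 : ℤ) ≤ l := by exact_mod_cast h2
  have hB : (1 : ℤ) ≤ (l : ℤ) ^ r := one_le_pow₀ (by linarith)
  have hR := hasOrd_artin h2 one_notMem_ordFilt (hord r) hB
  have hξ0 := (hord r).1
  have hR0 := hR.1
  obtain ⟨y, hy⟩ : ∃ y, y = ψ (b • (ξ r)⁻¹) := ⟨_, rfl⟩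
  have hyl : y ^ l + y = ψ (b • (ξ (r + 1) ^ l + ξ (r + 1))⁻¹) := by
    rw [hy, ← map_pow, ← map_add, smul_pow, hb, ← smul_add, hξ r]
    congr 2
    have hξl := pow_ne_zero l hξ0
    rw [mul_inv, inv_inv, pow_succ, inv_pow]
    field_simp
    ring
  obtain ⟨w', hw'⟩ : ∃ w', w' = c.φ w - (y ^ l + y) := ⟨_, rfl⟩
  have hw'0 : w' ∈ c.F.L 0 := by rw [hw', hyl]; exact hW
  have hym : y ∈ c.F.L (-(l : ℤ) ^ r) := by
    rw [hy]
    exact hψ _ _ (Submodule.smul_mem _ _ (hord r).2.2)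
  have hroot : AS.root l w' ^ l + AS.root l w' = AS.of k l _ w' := by
    rw [AS.root_pow (k := k)]; ring
  have h : (AS.root l w' + AS.of k l w' y) ^ l + (AS.root l w' + AS.of k l w' y) =
      AS.of k l w' (c.φ w) := by
    have e : AS.of k l w' (c.φ w) = AS.of k l w' w' + (AS.of k l w' y ^ l + AS.of k l w' y) := by
      rw [← map_pow, ← map_add, ← map_add, hw', sub_add_cancel]
    rw [e, IsSquareField.add_pow k p l, ← hroot]
    ring
  have hX := AS.map_root c.φ y w' h
  have hof := AS.map_of c.φ y w' h
  obtain ⟨X, hXdef⟩ : ∃ X, X = AS.root l w' + AS.of k l w' y := ⟨_, rfl⟩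
  have hvw : AS.of k l w' (c.φ w) * AS.of k l w' (c.φ v) = 1 := by
    rw [← map_mul, ← map_mul, hwv, map_one, map_one]
  have hr0 := c.F.root_mem_etale (l := l) hw'0
  have hvm : AS.of k l w' (c.φ v) ∈ (c.F.etale hw'0).L (l * (l : ℤ) ^ r) := by
    have := c.F.of_mem_etale (l := l) hw'0 hv
    rwa [pow_succ', Nat.cast_mul, Nat.cast_pow] at this
  have hXm : X ∈ (c.F.etale hw'0).L (-(l : ℤ) ^ r) := by
    rw [hXdef]
    exact add_mem ((c.F.etale hw'0).anti (by linarith) hr0) (c.F.of_mem_etale hw'0 hym)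
  refine ⟨⟨AS l w', AS.map c.φ y w' h, c.F.etale hw'0, 1, l * c.ρ,
    AS.of k l w' c.t, AS.of k l w' c.t', le_rfl,
    c.F.codim_etale hw'0 c.codim, c.F.of_mem_etale hw'0 c.t_mem, c.F.of_mem_etale hw'0 c.t'_mem,
    by rw [← map_mul, c.mul_eq, map_one], ?_, Or.inr ⟨rfl, r, ?_, (AS.of k l w').comp ψ, ?_,
      b, hb, ?_⟩⟩, by rw [he]; ring, ?_⟩
  · rw [hof]
    have := c.z_mem
    rw [he] at this
    exact c.F.of_mem_etale hw'0 this
  · have := map_nextV (l := l) (X := AS.root l w) (v := AS.of k l w v)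
      (AS.map c.φ y w' h)
    rw [this, hX, hof, ← hXdef, Nat.cast_pow]
    exact nextV_mem _ (by linarith) (by omega) hXm hvm
  · exact fun b x hx => c.F.of_mem_etale hw'0 (hψ b x hx)
  · have := map_nextW (l := l) (X := AS.root l w) (v := AS.of k l w v)
      (AS.map c.φ y w' h)
    rw [this, hX, hof, nextW_eq h hvw, ← hXdef]
    have e : X - X ^ 2 * AS.of k l w' (c.φ v) -
        (AS.of k l w').comp ψ (b • (ξ r ^ l + ξ r)⁻¹) = AS.root l w' +
          AS.of k l w' (ψ (b • (ξ r ^ (l - 1) * (ξ r ^ l + ξ r)⁻¹))) -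
          X ^ 2 * AS.of k l w' (c.φ v) := by
      have e1 : ξ r ^ (l - 1) * (ξ r ^ l + ξ r)⁻¹ = (ξ r)⁻¹ - (ξ r ^ l + ξ r)⁻¹ := by
        rw [eq_sub_iff_add_eq, ← mul_inv_cancel_right₀ hR0 (ξ r)⁻¹]
        have e2 : ξ r ^ l = ξ r ^ (l - 1) * ξ r := by rw [← pow_succ, show l - 1 + 1 = l by omega]
        rw [e2]
        field_simp
      rw [e1, smul_sub, map_sub, map_sub, hXdef, hy]
      simp only [AlgHom.comp_apply]
      ring
    rw [e]
    refine sub_mem (add_mem hr0 (c.F.of_mem_etale hw'0 (hψ _ _ (Submodule.smul_mem _ _ ?_))))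
      ((c.F.etale hw'0).mul' ((c.F.etale hw'0).pow hXm 2) hvm ?_)
    · refine (ordFilt k).mul' ((hord r).pow (l - 1)).2.1 hR.inv.2.1 ?_
      have : (1 : ℤ) ≤ (l - 1 : ℕ) := by omega
      nlinarith
    · push_cast
      nlinarith
  · refine Place.over_map c.φ y w' h _ _ fun x => ?_
    have e0 : (-(c.e - 1 : ℕ) : ℤ) = 0 := by simp [he]
    rw [e0]
    exact c.F.mem_etale hw'0

theorem step [hk : IsSquareField k p l]
    (hξ0 : ξ 0 ^ l + ξ 0 = LS.single 1 1)
    (hξ : ∀ j, ξ (j + 1) ^ l + ξ (j + 1) = ξ j ^ (l + 1) * (ξ j ^ l + ξ j)⁻¹)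
    (hord : ∀ j, HasOrd (ordFilt k) (ξ j) ((l : ℤ) ^ j))
    (c : Comp k l ξ w v z) (hwv : w * v = 1) :
    ∃ c' : Comp k l ξ (nextW l (AS.root l w) (AS.of k l w v))
        (nextV l (AS.root l w) (AS.of k l w v)) (AS.of k l w z),
      c'.ρ * c'.e = l * (c.ρ * c.e) ∧ Place.Over c.place c'.place := by
  rcases c.pole with hc | ⟨he, r, hc⟩
  · exact step_simple c hwv hc
  rcases r with _ | r
  · refine step_simple c hwv ?_
    obtain ⟨hv, ψ, hψ, b, hb, hW⟩ := hc
    refine ⟨?_, by simpa using hv⟩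
    rw [hξ0] at hW
    have := hψ _ _ (Submodule.smul_mem _ b (hasOrd_single (k := k) 1).2.2)
    simpa using add_mem (c.F.anti (by simp) hW) this
  · exact step_deep (p := p) hξ hord c hwv he hc

end Comp

/-- The place defined by a homomorphism to Laurent series. -/
noncomputable def zPlace {k A : Type} [Field k] [CommRing A] [Algebra k A] (φ : A →ₐ[k] LS k) :
    Place k A :=
  ⟨LS k, φ, (ordFilt k).L 0⟩

theorem add_root {k : Type} [Field k] {p l : ℕ} [hk : IsSquareField k p l]
    {R : Type} [CommRing R] [Algebra k R] {x y : R} (h : x ^ l + x = y)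
    (α : (IsSquareField.artin k p l).ker) :
    (x + algebraMap k R α) ^ l + (x + algebraMap k R α) = y := by
  have hα : (α : k) ^ l + α = 0 := α.2
  have := congrArg (algebraMap k R) hα
  rw [map_add, map_pow, map_zero] at this
  rw [IsSquareField.add_pow k p l]
  linear_combination h + this

section residue

variable {k : Type} [Field k] {l : ℕ} [hl : Fact (2 ≤ l)] {ξ : ℕ → LS k}
    {A : Type} [CommRing A] [Algebra k A] {w v z : A} {p : ℕ} [hk : IsSquareField k p l]

theorem Comp.exists_of_zPlace (hord : ∀ j, HasOrd (ordFilt k) (ξ j) ((l : ℤ) ^ j))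
    (hwv : w * v = 1) (φ : A →ₐ[k] LS k) {j : ℕ} (hφw : ξ j ^ l + ξ j = φ w)
    (hφz : φ z = LS.single 1 1) (α : (IsSquareField.artin k p l).ker) (hα : α ≠ 0) :
    ∃ c : Comp k l ξ (nextW l (AS.root l w) (AS.of k l w v))
        (nextV l (AS.root l w) (AS.of k l w v)) (AS.of k l w z),
      c.ρ * c.e = 1 ∧ c.place = zPlace (AS.lift φ _ (add_root hφw α)) := by
  have h2 := hl.out
  have hB : (1 : ℤ) ≤ (l : ℤ) ^ j := one_le_pow₀ (by omega)
  have hα0 : (α : k) ≠ 0 := fun h => hα (Subtype.ext h)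
  have hαl : (α : k) ^ l + α = 0 := α.2
  obtain ⟨X, hX⟩ : ∃ X, X = ξ j + algebraMap k (LS k) α := ⟨_, rfl⟩
  have hXw : X ^ l + X = φ w := by rw [hX]; exact add_root hφw α
  have hφwv : φ w * φ v = 1 := by rw [← map_mul, hwv, map_one]
  have hR := hasOrd_artin h2 one_notMem_ordFilt (hord j) hB
  have hφv : φ v = (ξ j ^ l + ξ j)⁻¹ := by
    rw [hφw]
    exact (inv_eq_of_mul_eq_one_right hφwv).symm
  have hXord : HasOrd (ordFilt k) X 0 := by
    rw [hX, add_comm]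
    exact HasOrd.add_of_zero one_notMem_ordFilt (HasOrd.algebraMap hα0)
      ((ordFilt k).anti hB (hord j).2.1)
  have hT := hasOrd_single (k := k) 1
  have hroot := AS.lift_root φ _ (add_root hφw α)
  have hof := AS.lift_of φ _ (add_root hφw α)
  refine ⟨⟨LS k, AS.lift φ _ (add_root hφw α), ordFilt k, 1, 1, LS.single 1 1,
    (LS.single 1 1)⁻¹, le_rfl, codim_ordFilt, hT.2.1, hT.2.2, mul_inv_cancel₀ hT.1, ?_,
    Or.inr ⟨rfl, j, ?_, AlgHom.id k _, fun b x hx => hx, (α : k) ^ (l + 1), ?_, ?_⟩⟩,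
    rfl, by simp [Comp.place, zPlace]⟩
  · rw [hof, hφz]
    exact hT.2.1
  · rw [map_nextV, hroot, hof, ← hX]
    have e : nextV l X (φ v) = (X ^ (l + 1))⁻¹ * (ξ j ^ l + ξ j) := by
      have := nextW_mul_nextV h2 hXw hφwv
      rw [eq_inv_of_mul_eq_one_right this, nextW, mul_inv, hφv, inv_inv]
    rw [e]
    exact (ordFilt k).mul' (hXord.pow (l + 1)).inv.2.1 hR.2.1 (by push_cast; simp)
  · calc ((α : k) ^ (l + 1)) ^ l = ((α : k) ^ l) ^ l * (α : k) ^ l := by ring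
      _ = (α : k) ^ (l + 1) := by rw [IsSquareField.pow_pow k p l, pow_succ']
  · rw [map_nextW, hroot, hof, ← hX]
    have e : nextW l X (φ v) - AlgHom.id k (LS k) ((α : k) ^ (l + 1) • (ξ j ^ l + ξ j)⁻¹) =
        (ξ j * (ξ j ^ (l - 1) * X + algebraMap k (LS k) ((α : k) ^ l))) * (ξ j ^ l + ξ j)⁻¹ := by
      rw [nextW, hφv, AlgHom.id_apply, Algebra.smul_def, pow_succ X, map_pow, map_pow]
      have e1 : X ^ l = ξ j ^ l + algebraMap k (LS k) α ^ l := by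
        rw [hX, IsSquareField.add_pow k p l]
      have e2 : ξ j ^ l = ξ j ^ (l - 1) * ξ j := by rw [← pow_succ, show l - 1 + 1 = l by omega]
      rw [e1, hX, e2]
      ring
    rw [e]
    have hmem : ξ j ^ (l - 1) * X + algebraMap k (LS k) ((α : k) ^ l) ∈ (ordFilt k).L 0 :=
      add_mem ((ordFilt k).mul' ((hord j).pow (l - 1)).2.1 hXord.2.1 (by positivity))
        ((ordFilt k).algebraMap_mem _)
    exact (ordFilt k).mul' ((ordFilt k).mul (hord j).2.1 hmem) hR.inv.2.1 (by simp)

end residue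

section interpolation

open Polynomial

variable {k : Type} [Field k]

theorem coeff_mul_mem {K : Type} [Field K] [Algebra k K] (F : Filt k K) {f g : K[X]}
    (hf : ∀ s, f.coeff s ∈ F.L 0) (hg : ∀ s, g.coeff s ∈ F.L 0) (s : ℕ) :
    (f * g).coeff s ∈ F.L 0 := by
  rw [coeff_mul]
  exact sum_mem fun x _ => F.mul' (hf _) (hg _) (by simp)

theorem coeff_C_mem {K : Type} [Field K] [Algebra k K] (F : Filt k K) {a : K}
    (ha : a ∈ F.L 0) (s : ℕ) : (C a).coeff s ∈ F.L 0 := by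
  rw [coeff_C]
  split_ifs
  · exact ha
  · exact zero_mem _

theorem eval_mem {K : Type} [Field K] [Algebra k K] (F : Filt k K) {f : K[X]} {x : K}
    (hf : ∀ s, f.coeff s ∈ F.L 0) (hx : x ∈ F.L 0) : f.eval x ∈ F.L 0 := by
  rw [eval_eq_sum_range]
  exact sum_mem fun s _ => F.mul' (hf s) (F.pow' hx s (c := 0) (by simp)) (by simp)

theorem coeff_mem_of_eval {K ι : Type} [Field K] [Algebra k K] (F : Filt k K) [Fintype ι]
    {x : K} (hx : x ∈ F.L 0) {a : ι → k} (ha : Function.Injective a) {f : K[X]}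
    (hd : f.degree < Fintype.card ι) (hf : ∀ i, f.eval (x + algebraMap k K (a i)) ∈ F.L 0) (s : ℕ) :
    f.coeff s ∈ F.L 0 := by
  classical
  have hinj : Set.InjOn (fun i => x + algebraMap k K (a i)) (Finset.univ : Finset ι) :=
    fun i _ j _ hij => ha ((algebraMap k K).injective (add_left_cancel hij))
  have h := Lagrange.eq_interpolate hinj (by simpa using hd)
  rw [Lagrange.interpolate_apply] at h
  rw [h, finsetSum_coeff]
  refine sum_mem fun i _ => coeff_mul_mem F (coeff_C_mem F (hf i)) ?_ s
  rw [Lagrange.basis]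
  refine Finset.prod_induction _ (fun g : K[X] => ∀ s, g.coeff s ∈ F.L 0)
    (fun f g => coeff_mul_mem F) ?_ ?_
  · rw [← C_1]
    exact coeff_C_mem F F.one
  · intro j _
    rw [Lagrange.basisDivisor]
    refine coeff_mul_mem F (coeff_C_mem F ?_) fun s => ?_
    · rw [add_sub_add_left_eq_sub, ← map_sub, ← map_inv₀]
      exact F.algebraMap_mem _
    · rw [coeff_sub, coeff_X]
      refine sub_mem ?_ (coeff_C_mem F (add_mem hx (F.algebraMap_mem _)) s)
      split_ifs
      · exact F.one
      · exact zero_mem _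

end interpolation

section step

open Polynomial

variable {k : Type} [Field k] {l : ℕ} [hl : Fact (2 ≤ l)]
    {A : Type} [CommRing A] [Algebra k A] {w : A} {p : ℕ} [hk : IsSquareField k p l]

/-- The elements all of whose coefficients lie in `U`. -/
noncomputable def coeffSubmodule (l : ℕ) [Fact (2 ≤ l)] (w : A) (U : Submodule k A) :
    Submodule k (AS l w) :=
  ⨅ s, U.comap (AS.cf k w s)

theorem mem_coeffSubmodule {U : Submodule k A} {u : AS l w} :
    u ∈ coeffSubmodule l w U ↔ ∀ s, (AS.rep u).coeff s ∈ U := by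
  rw [coeffSubmodule, Submodule.mem_iInf]
  rfl

theorem IsComplementary.step_surj {ι : Type} {U : Submodule k A} {P : ι → Place k A}
    {φ : A →ₐ[k] LS k} (h : IsComplementary U fun o : Option ι => o.elim (zPlace φ) P)
    {Q : ι → Place k (AS l w)} (hQ : ∀ i, (P i).Over (Q i)) {x : LS k} (hx : x ∈ (ordFilt k).L 0)
    (hφw : x ^ l + x = φ w) (η : ∀ i, (Q i).E) (ζ : (IsSquareField.artin k p l).ker → LS k) :
    ∃ u ∈ coeffSubmodule l w U, (∀ i, (Q i).φ u - η i ∈ (Q i).N) ∧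
      ∀ α, AS.lift φ _ (add_root hφw α) u - ζ α ∈ (ordFilt k).L 0 := by
  classical
  have hfin := IsSquareField.finite p l (k := k)
  have := Fintype.ofFinite (IsSquareField.artin k p l).ker
  have hcard : Fintype.card (IsSquareField.artin k p l).ker = l := by
    rw [← Nat.card_eq_fintype_card]
    exact (IsSquareField.card_ker_and_range k p l).1
  have hinj : Set.InjOn (fun α : (IsSquareField.artin k p l).ker => x + algebraMap k (LS k) α)
      (Finset.univ : Finset (IsSquareField.artin k p l).ker) :=
    fun i _ j _ hij => Subtype.ext ((algebraMap k (LS k)).injective (add_left_cancel hij))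
  choose y cf hcf hcfN using hQ
  let y' : ∀ o : Option ι, (o.elim (zPlace φ) P).E := fun o => match o with
    | none => (0 : LS k)
    | some i => y i
  obtain ⟨f0, hf0⟩ : ∃ f0 : (LS k)[X], f0 = Lagrange.interpolate Finset.univ
    (fun α : (IsSquareField.artin k p l).ker => x + algebraMap k (LS k) α) ζ := ⟨_, rfl⟩
  have hf0d : f0.degree < l := by
    rw [hf0]
    refine (Lagrange.degree_interpolate_lt _ hinj).trans_le ?_
    rw [Finset.card_univ, hcard]
  obtain ⟨u, hd, hu, huf⟩ := h.poly_surj y' l fun o => match o with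
    | none => f0
    | some i => cf i (η i)
  have hrep := AS.rep_mk (w := w) hd
  refine ⟨AdjoinRoot.mk _ u, ?_, fun i => ?_, fun α => ?_⟩
  · rw [mem_coeffSubmodule, hrep]
    exact hu
  · refine (hcfN i _).2 fun s hs => ?_
    have := huf (some i) s hs
    rw [map_sub, hcf, hrep]
    exact this
  · have e : AS.lift φ _ (add_root hφw α) (AdjoinRoot.mk _ u) - ζ α =
        (u.map (φ : A →+* LS k) - f0).eval (x + algebraMap k (LS k) α) := by
      rw [eval_sub, AS.lift_eq, hrep, hf0,
        Lagrange.eval_interpolate_at_node _ hinj (Finset.mem_univ α)]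
    rw [e]
    refine eval_mem _ (fun s => ?_) (add_mem hx ((ordFilt k).algebraMap_mem _))
    rcases lt_or_ge s l with hs | hs
    · have := huf none s hs
      have e1 : taylor (y' none) = LinearMap.id := taylor_zero'
      rw [e1] at this
      exact this
    · rw [coeff_eq_zero_of_degree_lt]
      · exact zero_mem _
      · exact (degree_sub_le _ _).trans_lt (lt_of_lt_of_le
          (max_lt (degree_map_le.trans_lt hd) hf0d) (Nat.cast_le.2 hs))

theorem IsComplementary.step_inj {ι : Type} {U : Submodule k A} {P : ι → Place k A}
    {φ : A →ₐ[k] LS k} (h : IsComplementary U fun o : Option ι => o.elim (zPlace φ) P)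
    {Q : ι → Place k (AS l w)} (hQ : ∀ i, (P i).Over (Q i)) {x : LS k} (hx : x ∈ (ordFilt k).L 0)
    (hφw : x ^ l + x = φ w) {u : AS l w} (hu : u ∈ coeffSubmodule l w U)
    (huQ : ∀ i, (Q i).φ u ∈ (Q i).N) (huZ : ∀ α : (IsSquareField.artin k p l).ker,
      AS.lift φ _ (add_root hφw α) u ∈ (ordFilt k).L 0) : u = 0 := by
  have hfin := IsSquareField.finite p l (k := k)
  have := Fintype.ofFinite (IsSquareField.artin k p l).ker
  have hcard : Fintype.card (IsSquareField.artin k p l).ker = l := by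
    rw [← Nat.card_eq_fintype_card]
    exact (IsSquareField.card_ker_and_range k p l).1
  choose y cf hcf hcfN using hQ
  let y' : ∀ o : Option ι, (o.elim (zPlace φ) P).E := fun o => match o with
    | none => (0 : LS k)
    | some i => y i
  rw [mem_coeffSubmodule] at hu
  apply AS.rep_injective
  rw [map_zero]
  refine h.poly_inj y' l _ (AS.degree_rep_lt u) hu ?_
  rintro (_ | i) s hs
  · have e1 : taylor (y' none) = LinearMap.id := taylor_zero'
    rw [e1]
    refine coeff_mem_of_eval (ordFilt k) hx
      (a := fun α : (IsSquareField.artin k p l).ker => (α : k))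
      Subtype.val_injective ?_ (fun α => ?_) s
    · rw [hcard]
      exact degree_map_le.trans_lt (AS.degree_rep_lt u)
    · have := huZ α
      rw [AS.lift_eq] at this
      exact this
  · have := (hcfN i _).1 (huQ i) s hs
    rw [hcf] at this
    exact this

theorem IsComplementary.step {ι : Type} {U : Submodule k A} {P : ι → Place k A}
    {φ : A →ₐ[k] LS k} (h : IsComplementary U fun o : Option ι => o.elim (zPlace φ) P)
    {Q : ι → Place k (AS l w)} (hQ : ∀ i, (P i).Over (Q i)) {x : LS k} (hx : x ∈ (ordFilt k).L 0)
    (hφw : x ^ l + x = φ w) : IsComplementary (coeffSubmodule l w U)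
      fun o : Option (ι ⊕ {α : (IsSquareField.artin k p l).ker // α ≠ 0}) =>
        o.elim (zPlace (AS.lift φ x hφw))
          (Sum.elim Q fun α => zPlace (AS.lift φ _ (add_root hφw α.1))) := by
  classical
  have h0 : ∀ u, AS.lift φ _ (add_root hφw (0 : (IsSquareField.artin k p l).ker)) u =
      AS.lift φ x hφw u := fun u => by
    rw [AS.lift_eq, AS.lift_eq]
    simp
  constructor
  · intro η
    obtain ⟨ζ, hζ0, hζ⟩ : ∃ ζ : (IsSquareField.artin k p l).ker → LS k, ζ 0 = η none ∧
        ∀ α (hα : α ≠ 0), ζ α = η (some (Sum.inr ⟨α, hα⟩)) :=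
      ⟨fun α => if hα : α = 0 then η none else η (some (Sum.inr ⟨α, hα⟩)), dif_pos rfl,
        fun α hα => dif_neg hα⟩
    obtain ⟨u, hu, huQ, huZ⟩ := h.step_surj (p := p) hQ hx hφw (fun i => η (some (Sum.inl i))) ζ
    refine ⟨u, hu, ?_⟩
    rintro (_ | i | α)
    · have := huZ 0
      rw [hζ0, h0] at this
      exact this
    · exact huQ i
    · have := huZ α.1
      rw [hζ α.1 α.2] at this
      exact this
  · intro u hu hue
    refine h.step_inj (p := p) hQ hx hφw hu (fun i => hue (some (Sum.inl i))) fun α => ?_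
    by_cases hα : α = 0
    · rw [hα, h0]
      exact hue none
    · exact hue (some (Sum.inr ⟨α, hα⟩))

end step

section rational

open LaurentPolynomial

variable {k : Type} [Field k]

/-- Evaluation of Laurent polynomials at a unit. -/
noncomputable def evalUnit {S : Type} [CommRing S] [Algebra k S] (x : Sˣ) : k[T;T⁻¹] →ₐ[k] S where
  __ := LaurentPolynomial.eval₂ (algebraMap k S) x
  commutes' r := LaurentPolynomial.eval₂_C (algebraMap k S) x r

theorem evalUnit_T {S : Type} [CommRing S] [Algebra k S] (x : Sˣ) (n : ℤ) :
    evalUnit (k := k) x (T n) = ((x ^ n : Sˣ) : S) :=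
  LaurentPolynomial.eval₂_T (algebraMap k S) x n

theorem evalUnit_toLaurent {S : Type} [CommRing S] [Algebra k S] (x : Sˣ) (P : Polynomial k) :
    evalUnit x (Polynomial.toLaurent P) = Polynomial.aeval (x : S) P :=
  LaurentPolynomial.eval₂_toLaurent (algebraMap k S) x P

theorem single_zpow (n : ℤ) : (LS.single 1 (1 : k)) ^ n = LS.single n 1 := by
  have hmul : ∀ a b : ℤ, LS.single a (1 : k) * LS.single b 1 = LS.single (a + b) 1 := fun a b => by
    have := HahnSeries.single_mul_single (R := k) (a := a) (b := b) (r := 1) (s := 1)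
    rw [mul_one] at this
    exact this
  have h0 : LS.single 1 (1 : k) ≠ 0 := (hasOrd_single 1).1
  induction n with
  | zero => rw [zpow_zero]; rfl
  | succ n ih => rw [zpow_add_one₀ h0, ih, hmul]
  | pred n ih =>
    rw [zpow_sub_one₀ h0, ih, mul_inv_eq_iff_eq_mul₀ h0, hmul, sub_add_cancel]

variable (k) in
/-- The expansion of Laurent polynomials at the origin. -/
noncomputable def expand : k[T;T⁻¹] →ₐ[k] LS k :=
  evalUnit (Units.mk0 (LS.single 1 (1 : k)) (hasOrd_single 1).1)

theorem expand_T (n : ℤ) : expand k (T n) = LS.single n 1 := by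
  rw [expand, evalUnit_T, Units.val_zpow_eq_zpow_val, Units.val_mk0, single_zpow]

theorem coeff_expand (f : k[T;T⁻¹]) (i : ℤ) : (expand k f).coeff i = f.coeff i := by
  induction f using LaurentPolynomial.induction_on' with
  | add f g hf hg => rw [map_add, LS.coeff_add, hf, hg]; rfl
  | C_mul_T n a =>
    rw [← LaurentPolynomial.smul_eq_C_mul, map_smul, LS.coeff_smul, expand_T, LS.coeff_single,
      AddMonoidAlgebra.coeff_smul, Finsupp.smul_apply, T_apply, smul_eq_mul]
    simp only [eq_comm]

variable (k) in
/-- The expansion of Laurent polynomials at infinity. -/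
noncomputable def expandInv : k[T;T⁻¹] →ₐ[k] LS k :=
  (expand k).comp (LaurentPolynomial.invert (R := k) : k[T;T⁻¹] →ₐ[k] k[T;T⁻¹])

theorem expandInv_T (n : ℤ) : expandInv k (T n) = LS.single (-n) 1 := by
  rw [expandInv, AlgHom.comp_apply]
  exact (congrArg _ (invert_T n)).trans (expand_T _)

theorem coeff_expandInv (f : k[T;T⁻¹]) (i : ℤ) : (expandInv k f).coeff i = f.coeff (-i) := by
  rw [expandInv, AlgHom.comp_apply, coeff_expand]
  exact invert_apply f i

/-- The preimage of a filtration. -/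
def Filt.comap {E E' : Type} [CommRing E] [CommRing E'] [Algebra k E] [Algebra k E'] (F : Filt k E')
    (φ : E →ₐ[k] E') : Filt k E where
  L b := (F.L b).comap φ.toLinearMap
  anti h _ hx := F.anti h hx
  mul {a b x y} hx hy := by
    have : φ (x * y) ∈ F.L (a + b) := by
      rw [map_mul]
      exact F.mul hx hy
    exact this
  one := by
    have : φ 1 ∈ F.L 0 := by
      rw [map_one]
      exact F.one
    exact this
  exh x := F.exh (φ x)

theorem Filt.mem_comap {E E' : Type} [CommRing E] [CommRing E'] [Algebra k E] [Algebra k E']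
    {F : Filt k E'} {φ : E →ₐ[k] E'} {b : ℤ} {x : E} : x ∈ (F.comap φ).L b ↔ φ x ∈ F.L b := Iff.rfl

theorem isPole_expandInv :
    IsPole ((ordFilt k).comap (expandInv k)) (T 1 : k[T;T⁻¹]) (T (-1)) := by
  refine ⟨by rw [← T_add]; simp, ?_, ?_, fun x hx => ⟨x.coeff 0, ?_⟩, ?_, fun x hx => ?_⟩
  · rw [Filt.mem_comap, expandInv_T]
    exact single_mem_ordFilt _ _
  · rw [Filt.mem_comap, expandInv_T, neg_neg]
    exact single_mem_ordFilt _ _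
  · rw [Filt.mem_comap, mem_ordFilt] at hx ⊢
    intro i hi
    rw [map_sub, AlgHom.commutes, LS.coeff_sub, Algebra.algebraMap_eq_smul_one, LS.coeff_smul,
      LS.coeff_one]
    split_ifs with h
    · rw [h, coeff_expandInv, neg_zero, mul_one, sub_self]
    · rw [hx i (by omega), mul_zero, sub_zero]
  · rw [Filt.mem_comap, map_one]
    exact one_notMem_ordFilt
  · ext i
    have := hx (-i + 1)
    rw [Filt.mem_comap, mem_ordFilt] at this
    have h := this (-i) (by omega)
    rw [coeff_expandInv, neg_neg] at h
    rw [h]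
    rfl

theorem isComplementary_expand {ι : Type} [IsEmpty ι] (P : ι → Place k k[T;T⁻¹]) :
    IsComplementary (((ordFilt k).comap (expandInv k)).L 1)
      fun o : Option ι => o.elim (zPlace (expand k)) P := by
  constructor
  · intro η
    obtain ⟨x, hx⟩ : ∃ x : LS k, x = η none := ⟨_, rfl⟩
    obtain ⟨b, hb⟩ := (ordFilt k).exh x
    rw [mem_ordFilt] at hb
    refine ⟨∑ i ∈ Finset.Ico b 0, x.coeff i • T i, ?_, ?_⟩
    · refine sum_mem fun i hi => Submodule.smul_mem _ _ ?_
      rw [Filt.mem_comap, expandInv_T]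
      rw [Finset.mem_Ico] at hi
      exact (ordFilt k).anti (by omega) (single_mem_ordFilt _ _)
    · rintro (_ | i)
      · rw [← hx]
        have : expand k (∑ i ∈ Finset.Ico b 0, x.coeff i • T i) - x ∈ (ordFilt k).L 0 := by
          rw [mem_ordFilt]
          intro j hj
          rw [LS.coeff_sub, coeff_expand, AddMonoidAlgebra.coeff_sum, Finsupp.finsetSum_apply]
          simp only [AddMonoidAlgebra.coeff_smul, Finsupp.smul_apply, T_apply, smul_eq_mul,
            mul_ite, mul_one, mul_zero]
          rw [Finset.sum_ite_eq' , sub_eq_zero]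
          split_ifs with h
          · rfl
          · rw [Finset.mem_Ico] at h
            exact (hb j (by omega)).symm
        exact this
      · exact isEmptyElim i
  · intro u hu h
    have h0 : expand k u ∈ (ordFilt k).L 0 := h none
    rw [mem_ordFilt] at h0
    rw [Filt.mem_comap, mem_ordFilt] at hu
    ext i
    rcases lt_or_ge i 0 with hi | hi
    · rw [← coeff_expand, h0 i hi]
      rfl
    · have := hu (-i) (by omega)
      rw [coeff_expandInv, neg_neg] at this
      rw [this]
      rfl

theorem evalUnit_vanish {d : ℕ} [NeZero d] (hd : Nat.card {b : k // b ^ d = 1} = d) (f : k[T;T⁻¹])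
    (hf : ∀ b : kˣ, (b : k) ^ d = 1 → evalUnit (k := k) b f = 0) :
    ∃ u, f = (T 1 ^ d - 1) * u := by
  obtain ⟨n, P, hP⟩ := LaurentPolynomial.exists_T_pow f
  obtain ⟨Q, hQ⟩ : ∃ Q, Q = (Polynomial.X : Polynomial k) ^ d - 1 := ⟨_, rfl⟩
  have hQm : Q.Monic := by
    rw [hQ]
    exact Polynomial.monic_X_pow_sub_C 1 (NeZero.ne d)
  have hfin : Finite {b : k // b ^ d = 1} :=
    Nat.finite_of_card_ne_zero (by rw [hd]; exact NeZero.ne d)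
  have := Fintype.ofFinite {b : k // b ^ d = 1}
  have hP0 : ∀ b : {b : k // b ^ d = 1}, P.eval b.1 = 0 := fun b => by
    have hb0 : b.1 ≠ 0 := fun h => by
      have := b.2
      rw [h, zero_pow (NeZero.ne d)] at this
      exact zero_ne_one this
    have h1 := evalUnit_toLaurent (Units.mk0 b.1 hb0) P
    rw [hP, map_mul, hf _ b.2, zero_mul] at h1
    simpa using h1.symm
  have hdvd : P %ₘ Q = 0 := by
    refine Polynomial.eq_zero_of_degree_lt_of_eval_index_eq_zero (s := Finset.univ)
      (v := fun b : {b : k // b ^ d = 1} => b.1) Subtype.val_injective.injOn ?_ fun b _ => ?_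
    · rw [Finset.card_univ, ← Nat.card_eq_fintype_card, hd]
      refine (Polynomial.degree_modByMonic_lt _ hQm).trans_eq ?_
      rw [hQ]
      exact Polynomial.degree_X_pow_sub_C (Nat.pos_of_ne_zero (NeZero.ne d)) 1
    · have h := congrArg (Polynomial.eval b.1) (Polynomial.modByMonic_add_div P Q)
      have hQb : Q.eval b.1 = 0 := by rw [hQ]; simp [b.2]
      rw [Polynomial.eval_add, Polynomial.eval_mul, hQb, zero_mul, add_zero, hP0] at h
      exact h
  obtain ⟨R, hR⟩ := (Polynomial.modByMonic_eq_zero_iff_dvd hQm).1 hdvd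
  refine ⟨Polynomial.toLaurent R * T (-n), ?_⟩
  have hT : (T n : k[T;T⁻¹]) * T (-n) = 1 := by rw [← T_add]; simp
  have hQT : Polynomial.toLaurent Q = T 1 ^ d - 1 := by
    rw [hQ, map_sub, map_pow, Polynomial.toLaurent_X, map_one]
  rw [← mul_assoc, ← hQT, ← map_mul, ← hR, hP, mul_assoc, hT, mul_one]

end rational

/-- The `j`-th ring of the tower, with the functions `w = 1 / v` and `z = 1 / z'`, the filtration
at the totally ramified pole, the rational points, the zero of `z` where `ξ j` is defined and the
other components of the zero locus of `z`. -/
structure Level (k : Type) [Field k] (l : ℕ) (ξ : ℕ → LS k) (j : ℕ) {A : Type} [CommRing A]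
    [Algebra k A] (w v z z' : A) : Type 1 where
  /-- The filtration at the pole. -/
  F : Filt k A
  pole : IsPole F w v
  z_mul : z * z' = 1
  z'_mem : z' ∈ F.L (l ^ j : ℕ)
  /-- The index type of the rational points. -/
  G : Type
  /-- The rational points. -/
  pt : G → A →ₐ[k] k
  card_G : Nat.card G = (l - 1) * l ^ j
  pt_pow : ∀ g, pt g w ^ l = pt g w
  vanish : ∀ f, (∀ g, pt g f = 0) → ∃ u, f = (z ^ (l - 1) - 1) * u
  /-- The expansion at the zero of `z` where `ξ j` is defined. -/
  φ : A →ₐ[k] LS k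
  root_eq : ξ j ^ l + ξ j = φ w
  φ_z : φ z = LS.single 1 1
  /-- The index type of the other components. -/
  ι : Type
  [fintype : Fintype ι]
  /-- The other components. -/
  comp : ι → Comp k l ξ w v z
  sum_eq : ∑ i, (comp i).ρ * (comp i).e + 1 = l ^ j
  compl : IsComplementary (F.L 1) fun o : Option ι =>
    o.elim (zPlace φ) fun i => (comp i).place

attribute [instance] Level.fintype

section levels

variable {k : Type} [Field k] {l : ℕ} [hl : Fact (2 ≤ l)] {ξ : ℕ → LS k}

open LaurentPolynomial in
theorem Level.exists_zero (p : ℕ) [hk : IsSquareField k p l]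
    (hξ0 : ξ 0 ^ l + ξ 0 = LS.single 1 1) :
    Nonempty (Level k l ξ 0 (T 1 : k[T;T⁻¹]) (T (-1)) (T 1) (T (-1))) := by
  have h2 := hl.out
  have : NeZero (l - 1) := ⟨by omega⟩
  have hcard := IsSquareField.card_fixed k p l
  have hne : ∀ b : {b : k // b ^ (l - 1) = 1}, b.1 ≠ 0 := fun b h => by
    have := b.2
    rw [h, zero_pow (by omega)] at this
    exact zero_ne_one this
  refine ⟨⟨_, isPole_expandInv, isPole_expandInv.mul_eq, ?_, {b : k // b ^ (l - 1) = 1},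
    fun b => evalUnit (Units.mk0 b.1 (hne b)), by simpa using hcard, fun b => ?_, fun f hf => ?_,
    expand k, ?_, expand_T 1, Empty, Empty.elim, by simp, isComplementary_expand _⟩⟩
  · simpa using isPole_expandInv.v_mem
  · rw [evalUnit_T, zpow_one, Units.val_mk0]
    calc b.1 ^ l = b.1 ^ (l - 1) * b.1 := by rw [← pow_succ, Nat.sub_add_cancel (by omega)]
      _ = b.1 := by rw [b.2, one_mul]
  · refine evalUnit_vanish hcard f fun b hb => ?_
    have := hf ⟨b, hb⟩
    rwa [Units.mk0_val] at this
  · rw [hξ0, expand_T]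

variable {A : Type} [CommRing A] [Algebra k A] {w v z z' : A} {j : ℕ}

open Polynomial in
theorem AS.exists_eq_mul_of_lift {p : ℕ} [hk : IsSquareField k p l] {G : Type}
    (pt : G → A →ₐ[k] k) {c : A}
    (h : ∀ f, (∀ g, pt g f = 0) → ∃ u, f = c * u) {a : G → k}
    (ha : ∀ g, a g ^ l + a g = pt g w) (f : AS l w)
    (hf : ∀ g (α : (IsSquareField.artin k p l).ker), AS.lift (pt g) _ (add_root (ha g) α) f = 0) :
    ∃ u, f = AS.of k l w c * u := by
  have hfin := IsSquareField.finite p l (k := k)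
  have := Fintype.ofFinite (IsSquareField.artin k p l).ker
  have hcard : Fintype.card (IsSquareField.artin k p l).ker = l := by
    rw [← Nat.card_eq_fintype_card]
    exact (IsSquareField.card_ker_and_range k p l).1
  have h0 : ∀ s, ∃ u, (AS.rep f).coeff s = c * u := fun s => h _ fun g => by
    have hinj : Set.InjOn (fun α : (IsSquareField.artin k p l).ker => a g + algebraMap k k α)
        (Finset.univ : Finset (IsSquareField.artin k p l).ker) :=
      fun i _ j _ hij => Subtype.ext (add_left_cancel hij)
    have hP := eq_zero_of_degree_lt_of_eval_index_eq_zero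
      (f := (AS.rep f).map (pt g : A →+* k)) _ hinj ?_ fun α _ => ?_
    · have := congrArg (fun P => P.coeff s) hP
      simpa using this
    · rw [Finset.card_univ, hcard]
      exact degree_map_le.trans_lt (AS.degree_rep_lt f)
    · have := hf g α
      rwa [AS.lift_eq] at this
  choose u hu using h0
  refine ⟨∑ s ∈ Finset.range l, AS.of k l w (u s) * AS.root l w ^ s, ?_⟩
  conv_lhs => rw [AS.eq_sum k f]
  rw [Finset.mul_sum]
  refine Finset.sum_congr rfl fun s _ => ?_
  rw [hu, map_mul, mul_assoc]

omit hl in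
theorem IsSquareField.nextW_pow {p : ℕ} [hk : IsSquareField k p l] {a b c : k}
    (hb : b ^ l = b) (hc : b * c = 1) : nextW l a c ^ l = nextW l a c := by
  have hcl : c ^ l = c := by
    have h1 : b * c ^ l = 1 := by
      have := mul_pow b c l
      rw [hc, one_pow, hb] at this
      exact this.symm
    calc c ^ l = c * (b * c ^ l) := by linear_combination (-c ^ l) * hc
      _ = c := by rw [h1, mul_one]
  rw [nextW, mul_pow, hcl, ← pow_mul, mul_comm (l + 1), pow_mul, pow_succ,
    ← _root_.pow_mul, mul_comm l l, pow_mul, IsSquareField.pow_pow k p l]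
  ring

theorem Level.step {p : ℕ} [hk : IsSquareField k p l] (hξ0 : ξ 0 ^ l + ξ 0 = LS.single 1 1)
    (hξ : ∀ j, ξ (j + 1) ^ l + ξ (j + 1) = ξ j ^ (l + 1) * (ξ j ^ l + ξ j)⁻¹)
    (hord : ∀ j, HasOrd (ordFilt k) (ξ j) ((l : ℤ) ^ j)) (L : Level k l ξ j w v z z') :
    Nonempty (Level k l ξ (j + 1) (nextW l (AS.root l w) (AS.of k l w v))
      (nextV l (AS.root l w) (AS.of k l w v)) (AS.of k l w z) (AS.of k l w z')) := by
  classical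
  have h2 := hl.out
  have hfin := IsSquareField.finite p l (k := k)
  have := Fintype.ofFinite (IsSquareField.artin k p l).ker
  have hcard : Nat.card (IsSquareField.artin k p l).ker = l :=
    (IsSquareField.card_ker_and_range k p l).1
  have hwv := L.pole.mul_eq
  choose a ha using fun g => IsSquareField.exists_artin_eq k p l _ (L.pt_pow g)
  choose c hc hco using fun i => Comp.step (p := p) hξ0 hξ hord (L.comp i) hwv
  choose c' hc' hcz using fun α : {α : (IsSquareField.artin k p l).ker // α ≠ 0} =>
    Comp.exists_of_zPlace hord hwv L.φ L.root_eq L.φ_z α.1 α.2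
  have hx : ξ j ∈ (ordFilt k).L 0 := (ordFilt k).anti (by positivity) (hord j).2.1
  have hcompl := IsComplementary.step (p := p) L.compl hco hx L.root_eq
  refine ⟨⟨L.F.ram L.pole.w_mem, L.pole.ram, ?_, ?_, L.G × (IsSquareField.artin k p l).ker,
    fun g => AS.lift (L.pt g.1) _ (add_root (ha g.1) g.2), ?_, ?_, ?_,
    AS.lift L.φ (ξ j) L.root_eq, ?_, ?_, L.ι ⊕ {α : (IsSquareField.artin k p l).ker // α ≠ 0},
    Sum.elim c c', ?_, ?_⟩⟩
  · rw [← map_mul, L.z_mul, map_one]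
  · have := L.F.of_mem_ram (l := l) L.pole.w_mem L.z'_mem
    rw [pow_succ']
    push_cast at this ⊢
    exact this
  · rw [Nat.card_prod, L.card_G, hcard]
    ring
  · intro g
    rw [map_nextW, AS.lift_root, AS.lift_of]
    exact IsSquareField.nextW_pow (p := p) (L.pt_pow g.1)
      (by rw [← map_mul, hwv, map_one])
  · intro f hf
    obtain ⟨u, hu⟩ := AS.exists_eq_mul_of_lift (p := p) L.pt L.vanish ha f fun g α => hf (g, α)
    exact ⟨u, by rw [hu]; simp⟩
  · rw [map_nextW, AS.lift_root, AS.lift_of, nextW, hξ, L.root_eq,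
      ← inv_eq_of_mul_eq_one_right (a := L.φ w) (b := L.φ v)]
    rw [← map_mul, hwv, map_one]
  · rw [AS.lift_of, L.φ_z]
  · have h1 : ∀ α, (c' α).ρ * (c' α).e = 1 := hc'
    rw [Fintype.sum_sum_type]
    simp only [Sum.elim_inl, Sum.elim_inr, hc, h1]
    rw [← Finset.mul_sum, Finset.sum_const, Finset.card_univ, pow_succ', ← L.sum_eq,
      Fintype.card_subtype_compl, Fintype.card_subtype_eq, ← Nat.card_eq_fintype_card, hcard,
      smul_eq_mul, mul_one, mul_add, mul_one]
    omega
  · have hU : coeffSubmodule l w (L.F.L 1) = (L.F.ram L.pole.w_mem).L 1 := by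
      ext u
      have := L.F.mem_ram_iff (l := l) L.pole.w_mem (x := u) 1
      rw [mul_one, sub_self, zero_add] at this
      rw [mem_coeffSubmodule, this]
      refine ⟨fun h s _ => h s, fun h s => ?_⟩
      rcases lt_or_ge s l with hs | hs
      · exact h s hs
      · rw [AS.rep_coeff_eq_zero _ hs]
        exact zero_mem _
    rw [hU] at hcompl
    convert hcompl using 1
    ext1 o
    rcases o with _ | i | α
    · rfl
    · rfl
    · exact hcz α

theorem Level.exists_level {p : ℕ} [hk : IsSquareField k p l]
    (hξ0 : ξ 0 ^ l + ξ 0 = LS.single 1 1)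
    (hξ : ∀ j, ξ (j + 1) ^ l + ξ (j + 1) = ξ j ^ (l + 1) * (ξ j ^ l + ξ j)⁻¹)
    (hord : ∀ j, HasOrd (ordFilt k) (ξ j) ((l : ℤ) ^ j)) (j : ℕ) :
    ∃ (A : Type) (_ : CommRing A) (_ : Algebra k A) (w v z z' : A),
      Nonempty (Level k l ξ j w v z z') := by
  induction j with
  | zero => exact ⟨_, _, _, _, _, _, _, Level.exists_zero p hξ0⟩
  | succ j ih =>
    obtain ⟨A, _, _, w, v, z, z', ⟨L⟩⟩ := ih
    exact ⟨_, _, _, _, _, _, _, L.step (p := p) hξ0 hξ hord⟩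

end levels

section code

variable {k : Type} [Field k] {l : ℕ} [hl : Fact (2 ≤ l)] {ξ : ℕ → LS k}
    {A : Type} [CommRing A] [Algebra k A] {w v z z' : A} {j : ℕ}

omit hl in
/-- There are functions with a prescribed polynomial part at the pole which are almost integral at
all other places. -/
theorem Level.exists_linearMap (L : Level k l ξ j w v z z') :
    ∃ f : Polynomial k →ₗ[k] A, ∀ P, f P - Polynomial.aeval w P ∈ L.F.L 1 ∧
      L.φ (f P) ∈ (ordFilt k).L 0 ∧
      ∀ i, (L.comp i).φ (f P) ∈ (L.comp i).F.L (-((L.comp i).e - 1 : ℕ)) := by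
  have h1 : ∀ n : ℕ, ∃ u ∈ L.F.L 1, L.φ (u - w ^ n) ∈ (ordFilt k).L 0 ∧
      ∀ i, (L.comp i).φ (u - w ^ n) ∈ (L.comp i).F.L (-((L.comp i).e - 1 : ℕ)) := fun n => by
    obtain ⟨u, hu, h⟩ := L.compl.surj fun o => match o with
      | none => L.φ (w ^ n)
      | some i => (L.comp i).φ (w ^ n)
    refine ⟨u, hu, ?_, fun i => ?_⟩
    · rw [map_sub]
      exact h none
    · rw [map_sub]
      exact h (some i)
  choose u hu hφ hc using h1
  refine ⟨(Polynomial.basisMonomials k).constr k fun n => w ^ n - u n, fun P => ?_⟩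
  have hmon : ∀ n (a : k), (Polynomial.basisMonomials k).constr k (fun n => w ^ n - u n)
      (Polynomial.monomial n a) = a • (w ^ n - u n) := fun n a => by
    have := (Polynomial.basisMonomials k).constr_basis k (fun n => w ^ n - u n) n
    rw [Polynomial.coe_basisMonomials] at this
    rw [← this, ← map_smul, Polynomial.smul_monomial, smul_eq_mul, mul_one]
  induction P using Polynomial.induction_on' with
  | add P Q hP hQ =>
    refine ⟨?_, ?_, fun i => ?_⟩
    · rw [map_add, map_add, add_sub_add_comm]
      exact add_mem hP.1 hQ.1
    · rw [map_add, map_add]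
      exact add_mem hP.2.1 hQ.2.1
    · rw [map_add, map_add]
      exact add_mem (hP.2.2 i) (hQ.2.2 i)
  | monomial n a =>
    rw [hmon]
    refine ⟨?_, ?_, fun i => ?_⟩
    · rw [Polynomial.aeval_monomial, ← Algebra.smul_def, ← smul_sub, sub_sub_cancel_left]
      exact Submodule.smul_mem _ _ (neg_mem (hu n))
    · rw [map_smul, ← neg_sub, map_neg]
      exact Submodule.smul_mem _ _ (neg_mem (hφ n))
    · rw [map_smul, ← neg_sub, map_neg]
      exact Submodule.smul_mem _ _ (neg_mem (hc n i))

omit hl in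
theorem Level.exists_submodule (L : Level k l ξ j w v z z') (p I : ℕ) :
    ∃ V : Submodule k A, Module.Finite k V ∧
      I ≤ Module.finrank k V +
        ∑ i, (L.comp i).ρ * ((L.comp i).e - 1 - ((L.comp i).e - 1) / p) ∧
      ∀ f ∈ V, f ∈ L.F.L (-(I - 1 : ℕ)) ∧ L.φ f ∈ (ordFilt k).L 0 ∧
        ∀ i, (L.comp i).φ f ∈ (L.comp i).F.L (-(((L.comp i).e - 1) / p : ℕ)) := by
  obtain ⟨f, hf⟩ := L.exists_linearMap
  obtain ⟨d, hd⟩ : ∃ d : L.ι → ℕ, d = fun i => (L.comp i).e - 1 - ((L.comp i).e - 1) / p :=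
    ⟨_, rfl⟩
  have hcod : ∀ i, Codim ((L.comp i).ρ * d i) (L.comp i).place.N
      ((L.comp i).F.L (-(((L.comp i).e - 1) / p : ℕ))) := fun i => by
    have := Codim.range _ (L.comp i).codim (L.comp i).t_mem (L.comp i).t'_mem (L.comp i).mul_eq
      (((L.comp i).e - 1) / p) (d i)
    rw [hd] at this ⊢
    rw [Nat.add_sub_cancel' (Nat.div_le_self _ _)] at this
    exact this
  choose Φ hΦ using hcod
  let g : (Fin I → k) →ₗ[k] A := f ∘ₗ (Polynomial.degreeLT k I).subtype ∘ₗ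
    (Polynomial.degreeLTEquiv k I).symm.toLinearMap
  have hg : Function.Injective g := by
    rw [← LinearMap.ker_eq_bot, LinearMap.ker_eq_bot']
    intro c hc
    obtain ⟨P, rfl⟩ := (Polynomial.degreeLTEquiv k I).surjective c
    have hfP : f P = 0 := by simpa [g] using hc
    have h1 := (hf P).1
    rw [hfP, zero_sub] at h1
    have : (P : Polynomial k) = 0 := by
      by_contra hne
      exact L.pole.aeval_notMem hne (neg_mem_iff.1 h1)
    rw [Submodule.coe_eq_zero.1 this, map_zero]
  let Ψ : (Fin I → k) →ₗ[k] ((x : Σ i, Fin ((L.comp i).ρ * d i)) → k) := LinearMap.pi fun x =>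
    LinearMap.proj x.2 ∘ₗ Φ x.1 ∘ₗ (L.comp x.1).φ.toLinearMap ∘ₗ g
  refine ⟨(LinearMap.ker Ψ).map g, inferInstance, ?_, ?_⟩
  · have h1 := Ψ.finrank_range_add_finrank_ker
    have h2 := (LinearMap.range Ψ).finrank_le
    rw [Module.finrank_fintype_fun_eq_card] at h1 h2
    rw [Fintype.card_fin] at h1
    rw [Fintype.card_sigma] at h2
    simp only [Fintype.card_fin, hd] at h2
    rw [← (LinearMap.ker Ψ).equivMapOfInjective g hg |>.finrank_eq]
    omega
  · rintro _ ⟨c, hc, rfl⟩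
    obtain ⟨P, hP⟩ : ∃ P : Polynomial.degreeLT k I, P = (Polynomial.degreeLTEquiv k I).symm c :=
      ⟨_, rfl⟩
    have hgc : g c = f P := by rw [hP]; rfl
    refine ⟨?_, ?_, fun i => ?_⟩
    · rw [hgc, ← sub_add_cancel (f P) (Polynomial.aeval w (P : Polynomial k))]
      refine add_mem (L.F.anti (by omega) (hf P).1) ?_
      by_cases h0 : (P : Polynomial k) = 0
      · rw [h0, map_zero]
        exact zero_mem _
      rw [Polynomial.aeval_def, Polynomial.eval₂_eq_sum_range]
      refine sum_mem fun n hn => ?_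
      rw [← Algebra.smul_def]
      refine Submodule.smul_mem _ _ ?_
      have hn' := Polynomial.mem_degreeLT.1 P.2
      rw [Polynomial.degree_eq_natDegree h0, Nat.cast_lt] at hn'
      rw [Finset.mem_range] at hn
      exact L.F.pow' L.pole.w_mem n (by omega)
    · rw [hgc]
      exact (hf P).2.1
    · refine hΦ i _ ?_ ?_
      · rw [hgc]
        exact (hf P).2.2 i
      · ext x
        exact congrFun hc ⟨i, x⟩

theorem Level.eq_zero_of_vanish (L : Level k l ξ j w v z z') {f : A} (hf : ∀ g, L.pt g f = 0)
    {b : ℕ} (hb : b < (l - 1) * l ^ j) (hfF : f ∈ L.F.L (-b)) (hfφ : L.φ f ∈ (ordFilt k).L 0)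
    (hfc : ∀ i, (L.comp i).φ f ∈ (L.comp i).F.L (-((L.comp i).e - 1 : ℕ))) : f = 0 := by
  have h2 := hl.out
  obtain ⟨u, rfl⟩ := L.vanish f hf
  have hz : z ^ (l - 1) * z' ^ (l - 1) = 1 := by rw [← mul_pow, L.z_mul, one_pow]
  have hz' := L.F.pow L.z'_mem (l - 1)
  have hpos : 1 ≤ (l - 1) * l ^ j := Nat.mul_pos (by omega) (pow_pos (by omega) j)
  have hu : u = 0 := by
    refine L.compl.inj u ?_ ?_
    · refine L.F.mem_of_sub_mul_mem (t := z' ^ (l - 1)) ?_ ?_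
      · refine L.F.anti ?_ hz'
        exact_mod_cast hpos
      · have e : u - z' ^ (l - 1) * u = z' ^ (l - 1) * ((z ^ (l - 1) - 1) * u) := by
          linear_combination -u * hz
        rw [e]
        refine L.F.mul' hz' hfF ?_
        have : ((b + 1 : ℕ) : ℤ) ≤ ((l - 1) * l ^ j : ℕ) := by exact_mod_cast hb
        push_cast at this ⊢
        linarith
    · rintro (_ | i)
      · refine (ordFilt k).mem_of_sub_mul_mem (t := LS.single 1 1 ^ (l - 1)) ?_ ?_
        · exact (ordFilt k).pow' (single_mem_ordFilt 1 1) (l - 1) (by omega)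
        · have e : L.φ u - LS.single 1 1 ^ (l - 1) * L.φ u =
              -L.φ ((z ^ (l - 1) - 1) * u) := by
            rw [← L.φ_z]
            simp only [map_mul, map_sub, map_pow, map_one]
            ring
          have := neg_mem hfφ
          rw [← e] at this
          exact this
      · refine (L.comp i).F.mem_of_sub_mul_mem (t := (L.comp i).φ z ^ (l - 1)) ?_ ?_
        · refine (L.comp i).F.pow' (L.comp i).z_mem (l - 1) ?_
          have h1 := (L.comp i).one_le
          exact_mod_cast Nat.mul_pos (show 0 < l - 1 by omega) h1
        · have e : (L.comp i).φ u - (L.comp i).φ z ^ (l - 1) * (L.comp i).φ u =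
              -(L.comp i).φ ((z ^ (l - 1) - 1) * u) := by
            simp only [map_mul, map_sub, map_pow, map_one]
            ring
          have := neg_mem (hfc i)
          rw [← e] at this
          exact this
  rw [hu, mul_zero]

theorem IsPole.exists_eq_zero_of_prod {F : Filt k A} (h : IsPole F w v) {κ : Type} (s : Finset κ)
    {f : κ → A} (hf : ∏ a ∈ s, f a = 0) : ∃ a ∈ s, f a = 0 := by
  have : NoZeroDivisors A := ⟨h.noZeroDivisors⟩
  have : Nontrivial A := ⟨⟨1, 0, fun h1 => h.one_notMem (h1 ▸ zero_mem _)⟩⟩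
  exact Finset.prod_eq_zero_iff.1 hf

theorem Level.exists_code (L : Level k l ξ j w v z z') {p I : ℕ} (hp : 1 ≤ p)
    (hI : p * I = (l - 1) * l ^ j) :
    ∃ V : Submodule k A, Module.Finite k V ∧
      (l - 1) * l ^ j ≤ p * Module.finrank k V + (p - 1) * l ^ j ∧
      ∀ f : Fin p → A, (∀ a, f a ∈ V) → (∀ g, ∏ a, L.pt g (f a) = 0) → ∃ a, f a = 0 := by
  have h2 := hl.out
  obtain ⟨V, hfin, hV, hVm⟩ := L.exists_submodule p I
  refine ⟨V, hfin, ?_, fun f hf hprod => ?_⟩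
  · have h1 : ∀ i, p * ((L.comp i).ρ * ((L.comp i).e - 1 - ((L.comp i).e - 1) / p)) ≤
        (p - 1) * ((L.comp i).ρ * (L.comp i).e) := fun i => by
      have he := (L.comp i).one_le
      have h3 : p * ((L.comp i).e - 1 - ((L.comp i).e - 1) / p) ≤ (p - 1) * (L.comp i).e := by
        have h4 := Nat.div_add_mod ((L.comp i).e - 1) p
        have h5 := Nat.mod_lt ((L.comp i).e - 1) hp
        rw [Nat.mul_sub, Nat.sub_mul, one_mul, Nat.mul_sub, mul_one]
        have h6 : p * 1 ≤ p * (L.comp i).e := Nat.mul_le_mul_left p he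
        omega
      calc _ = (L.comp i).ρ * (p * ((L.comp i).e - 1 - ((L.comp i).e - 1) / p)) := by ring
        _ ≤ (L.comp i).ρ * ((p - 1) * (L.comp i).e) := Nat.mul_le_mul_left _ h3
        _ = _ := by ring
    have h3 := Finset.sum_le_sum fun i (_ : i ∈ Finset.univ) => h1 i
    rw [← Finset.mul_sum, ← Finset.mul_sum] at h3
    have h4 := Nat.mul_le_mul_left p hV
    rw [mul_add, hI] at h4
    have h5 : (p - 1) * ∑ i, (L.comp i).ρ * (L.comp i).e ≤ (p - 1) * l ^ j :=
      Nat.mul_le_mul_left _ (by have := L.sum_eq; omega)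
    omega
  · have hpos : 1 ≤ (l - 1) * l ^ j := Nat.mul_pos (by omega) (pow_pos (by omega) j)
    have hI1 : 1 ≤ I := by
      by_contra hI0
      have : I = 0 := by omega
      rw [this] at hI
      omega
    suffices h0 : ∏ a, f a = 0 by
      obtain ⟨a, -, ha⟩ := L.pole.exists_eq_zero_of_prod Finset.univ h0
      exact ⟨a, ha⟩
    refine L.eq_zero_of_vanish (b := p * (I - 1)) (fun g => by rw [map_prod, hprod g])
      (by rw [← hI]; exact Nat.mul_lt_mul_of_pos_left (by omega) hp) ?_ ?_ fun i => ?_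
    · have := L.F.prod Finset.univ f (-(I - 1 : ℕ)) fun a _ => (hVm _ (hf a)).1
      simpa using this
    · rw [map_prod]
      have := (ordFilt k).prod Finset.univ (fun a => L.φ (f a)) 0 fun a _ => (hVm _ (hf a)).2.1
      simpa using this
    · rw [map_prod]
      have := (L.comp i).F.prod Finset.univ (fun a => (L.comp i).φ (f a))
        (-(((L.comp i).e - 1) / p : ℕ)) fun a _ => (hVm _ (hf a)).2.2 i
      refine (L.comp i).F.anti ?_ this
      rw [Finset.card_univ, Fintype.card_fin, mul_neg, neg_le_neg_iff]
      exact_mod_cast Nat.mul_div_le _ _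

end code

section frameproof

/-- If every product of `s` nonzero differences of words of a code is nonzero at some position, then
the code is `s`-frameproof. -/
theorem IsFrameproof.range {K V S : Type*} [Field K] [Finite S] {n s : ℕ} (hn : 0 < n)
    (ev : V → Fin n → K) (σ : K ≃ S)
    (h : ∀ (f : V) (g : Fin s → V), (∀ i, ∏ t, (ev f i - ev (g t) i) = 0) → ∃ t, f = g t) :
    IsFrameproof s (Set.range fun f i => σ (ev f i)) := by
  intro A hA hcard
  refine Set.Subset.antisymm ?_ fun x hx => ⟨fun i => ⟨x, hx, rfl⟩, hA hx⟩
  rintro _ ⟨hx, f, rfl⟩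
  have hne : A.Nonempty := by
    obtain ⟨a, ha, -⟩ := hx ⟨0, hn⟩
    exact ⟨a, ha⟩
  have : Nonempty A := hne.to_subtype
  let ι : A → Fin s := fun a => Fin.castLE hcard (Finite.equivFin A a)
  have hι : Function.Injective ι := (Fin.castLE_injective hcard).comp (Finite.equivFin A).injective
  have hsurj := Function.invFun_surjective hι
  choose g hg using fun t => hA (Function.invFun ι t).2
  obtain ⟨t, rfl⟩ := h f g fun i => by
    obtain ⟨a, ha, hfa⟩ := hx i
    obtain ⟨t, ht⟩ := hsurj ⟨a, ha⟩
    refine Finset.prod_eq_zero (Finset.mem_univ t) (sub_eq_zero.2 (σ.injective ?_))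
    have := congrFun (hg t) i
    rw [ht] at this
    exact hfa.trans this.symm
  rw [hg t]
  exact (Function.invFun ι t).2

theorem bddAbove_frameproof (q n s : ℕ) :
    BddAbove {M | ∃ C : Set (Fin n → Fin q), IsFrameproof s C ∧ C.ncard = M} := by
  refine ⟨q ^ n, ?_⟩
  rintro _ ⟨C, -, rfl⟩
  refine (Set.ncard_le_card C).trans_eq ?_
  simp

theorem Mfp_le (q n s : ℕ) : Mfp q n s ≤ q ^ n := by
  refine csSup_le' ?_
  rintro _ ⟨C, -, rfl⟩
  refine (Set.ncard_le_card C).trans_eq ?_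
  simp

theorem logb_Mfp_div_le_one (q n s : ℕ) (hq : 1 < q) :
    Real.logb q (Mfp q n s) / n ≤ 1 := by
  have hq' : (1 : ℝ) < q := by exact_mod_cast hq
  refine div_le_one_of_le₀ ?_ n.cast_nonneg
  rcases Nat.eq_zero_or_pos (Mfp q n s) with h | h
  · simp [h]
  rw [Real.logb_le_iff_le_rpow hq' (by exact_mod_cast h), Real.rpow_natCast]
  exact_mod_cast Mfp_le q n s

theorem le_logb_Mfp {K A G : Type} [Field K] [Finite K] [CommRing A] [Algebra K A] {p : ℕ}
    (hp : 0 < p) (pt : G → A →ₐ[K] K) (hG : 0 < Nat.card G) (V : Submodule K A) [Module.Finite K V]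
    (hV : ∀ f : Fin p → A, (∀ a, f a ∈ V) → (∀ g, ∏ a, pt g (f a) = 0) → ∃ a, f a = 0) :
    (Module.finrank K V : ℝ) ≤ Real.logb (Nat.card K) (Mfp (Nat.card K) (Nat.card G) p) := by
  have : Finite G := Nat.finite_of_card_ne_zero hG.ne'
  have : Finite V := Module.finite_of_finite K
  let e := (Finite.equivFin G).symm
  let σ := Finite.equivFin K
  let ev : V → Fin (Nat.card G) → K := fun f i => pt (e i) f
  have h : ∀ (f : V) (g : Fin p → V), (∀ i, ∏ t, (ev f i - ev (g t) i) = 0) → ∃ t, f = g t := by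
    intro f g h0
    obtain ⟨a, ha⟩ := hV (fun t => (f - g t : V)) (fun t => Submodule.coe_mem _) fun x => by
      have := h0 (e.symm x)
      simpa [ev] using this
    exact ⟨a, sub_eq_zero.1 (Subtype.ext ha)⟩
  have hinj : Function.Injective fun f i => σ (ev f i) := fun f f' hff => by
    have : ev f = ev f' := funext fun i => σ.injective (congrFun hff i)
    obtain ⟨-, h1⟩ := h f (fun _ => f') fun i => by
      rw [this]
      exact Finset.prod_eq_zero (Finset.mem_univ ⟨0, hp⟩) (sub_self _)
    exact h1
  have hq : 1 < Nat.card K := Finite.one_lt_card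
  have hM : Nat.card K ^ Module.finrank K V ≤ Mfp (Nat.card K) (Nat.card G) p := by
    refine le_csSup (bddAbove_frameproof _ _ _) ⟨_, IsFrameproof.range hG ev σ h, ?_⟩
    rw [← Set.image_univ, Set.ncard_image_of_injective _ hinj, Set.ncard_univ,
      Module.natCard_eq_pow_finrank (K := K)]
  have hq' : (1 : ℝ) < Nat.card K := by exact_mod_cast hq
  have hpos : 0 < Nat.card K ^ Module.finrank K V := pow_pos (by omega) _
  rw [Real.le_logb_iff_rpow_le hq' (by exact_mod_cast hpos.trans_le hM), Real.rpow_natCast]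
  exact_mod_cast hM

end frameproof

/-- Lower bound for the rate of the codes on the tower. -/
theorem le_logb_Mfp_div (k : Type) [Field k] (p l : ℕ) [hk : IsSquareField k p l] (j : ℕ)
    (hj : 1 ≤ j) :
    1 / (p : ℝ) - (1 - 1 / p) / (l - 1) ≤
      Real.logb (l ^ 2 : ℕ) (Mfp (l ^ 2) ((l - 1) * l ^ j) p) / ((l - 1) * l ^ j : ℕ) := by
  have h2 := IsSquareField.two_le k p l
  have : Fact (2 ≤ l) := ⟨h2⟩
  have : Finite k := IsSquareField.finite p l
  have hp := (IsSquareField.prime k (p := p) (l := l)).pos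
  obtain ⟨ξ, hξ0, hξ, hord⟩ := exists_xi k p l
  obtain ⟨A, _, _, w, v, z, z', ⟨L⟩⟩ := Level.exists_level (p := p) hξ0 hξ hord j
  obtain ⟨I, hI⟩ : p ∣ (l - 1) * l ^ j :=
    Dvd.dvd.mul_left ((IsSquareField.dvd k p l).trans (dvd_pow_self l (by omega))) _
  obtain ⟨V, _, hV, hVp⟩ := L.exists_code hp hI.symm
  have hpos : 0 < (l - 1) * l ^ j := Nat.mul_pos (by omega) (pow_pos (by omega) j)
  have hlog := le_logb_Mfp hp L.pt (by rwa [L.card_G]) V hVp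
  rw [L.card_G, IsSquareField.card (k := k) (p := p) (l := l)] at hlog
  have hpos' : (0 : ℝ) < ((l - 1) * l ^ j : ℕ) := by exact_mod_cast hpos
  rw [le_div_iff₀ hpos']
  refine le_trans ?_ hlog
  have hV' : (((l - 1) * l ^ j : ℕ) : ℝ) ≤
      (p * Module.finrank k V + (p - 1) * l ^ j : ℕ) := by exact_mod_cast hV
  have hp' : (0 : ℝ) < p := by exact_mod_cast hp
  have hl' : (2 : ℝ) ≤ l := by exact_mod_cast h2
  push_cast [Nat.cast_sub (show 1 ≤ l by omega), Nat.cast_sub (show 1 ≤ p from hp)] at hV' ⊢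
  have hl1 : (0 : ℝ) < l - 1 := by linarith
  have e : (1 / (p : ℝ) - (1 - 1 / p) / (l - 1)) * ((l - 1) * l ^ j) =
      ((l - 1) * l ^ j - (p - 1) * l ^ j) / p := by
    field_simp
  rw [e, div_le_iff₀ hp']
  linarith

theorem le_Rfp (k : Type) [Field k] (p l : ℕ) [hk : IsSquareField k p l] :
    1 / (p : ℝ) - (1 - 1 / p) / (l - 1) ≤ Rfp (l ^ 2) p := by
  have h2 := IsSquareField.two_le k p l
  refine le_limsup_of_frequently_le ?_ ⟨1, ?_⟩
  · refine frequently_atTop.2 fun a => ⟨(l - 1) * l ^ (a + 1), ?_, ?_⟩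
    · calc a ≤ a + 1 := a.le_succ
        _ ≤ l ^ (a + 1) := (Nat.lt_pow_self (by omega)).le
        _ ≤ _ := Nat.le_mul_of_pos_left _ (by omega)
    · exact le_logb_Mfp_div k p l (a + 1) (by omega)
  · exact eventually_map.2 (Eventually.of_forall fun n =>
      logb_Mfp_div_le_one _ _ _ (Nat.one_lt_pow (by omega) (by omega)))

theorem isSquareField_galoisField (p m : ℕ) [hp : Fact p.Prime] (hm : 1 ≤ m) :
    IsSquareField (GaloisField p (2 * m)) p (p ^ m) where
  prime := hp.out
  charP := inferInstance
  exists_pow := ⟨m, hm, rfl⟩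
  finite := inferInstance
  card := by rw [GaloisField.card p (2 * m) (by omega), ← pow_mul, mul_comm]

/-- For a square prime power `q = p^{2m}` of characteristic `p` with
`2 ≤ p ≤ √q − 1 = p^m − 1`, one has
`R_q(p) ≥ 1/p − 1/(√q − 1) + (1 − (log_q p)/(√q + 1))/(p(√q − 1))`. -/
theorem stmt13 (p m q : ℕ) (hp : p.Prime) (hm : 1 ≤ m) (hq : q = p ^ (2 * m))
    (hp2 : 2 ≤ p) (hple : p ≤ p ^ m - 1) :
    1 / (p : ℝ) - 1 / ((p : ℝ) ^ m - 1) +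
        (1 - Real.logb q p / ((p : ℝ) ^ m + 1)) / ((p : ℝ) * ((p : ℝ) ^ m - 1)) ≤
      Rfp q p := by
  have : Fact p.Prime := ⟨hp⟩
  have := isSquareField_galoisField p m hm
  have hR := le_Rfp (GaloisField p (2 * m)) p (p ^ m)
  have hql : (p ^ m) ^ 2 = q := by rw [hq, ← pow_mul, mul_comm]
  rw [hql] at hR
  refine le_trans ?_ hR
  have hp' : (2 : ℝ) ≤ p := by exact_mod_cast hp2
  have hl' : (1 : ℝ) < (p : ℝ) ^ m := by
    exact_mod_cast show 1 < p ^ m by omega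
  have hl1 : (0 : ℝ) < (p : ℝ) ^ m - 1 := by linarith
  have hq1 : (1 : ℝ) < q := by
    rw [← hql]
    exact_mod_cast Nat.one_lt_pow (by omega) (show 1 < p ^ m by omega)
  have hlog : 0 ≤ Real.logb q p := Real.logb_nonneg hq1 (by linarith)
  have hε : 0 ≤ Real.logb q p / ((p : ℝ) ^ m + 1) := div_nonneg hlog (by linarith)
  generalize Real.logb q p / ((p : ℝ) ^ m + 1) = ε at hε
  push_cast
  have e : 1 / (p : ℝ) - (1 - 1 / p) / ((p : ℝ) ^ m - 1) =
      1 / (p : ℝ) - 1 / ((p : ℝ) ^ m - 1) + 1 / ((p : ℝ) * ((p : ℝ) ^ m - 1)) := by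
    field_simp
    ring
  rw [e]
  gcongr
  linarith
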